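/- For every u ∈ F there exists a unique Borel measure μ on K such that μ(K_w) = (1/R_{|w|}) · E^{𝒍^{|w|}}(u∘F_w, u∘F_w) for every w ∈ W_*; moreover this measure satisfies μ({x}) = 0 for every x ∈ K. -/

import Mathlib

open scoped BigOperators ENNReal
open Set Filter MeasureTheory

noncomputable section

abbrev E2 : Type := EuclideanSpace ℝ (Fin 2)

/-- The index set `S_l` of the level-`l` thin Sierpinski gasket. -/
def Sset (l : ℕ) : Set (ℕ × ℕ) :=
  {p | p.1 + p.2 ≤ l - 1 ∧ p.1 * p.2 * (l - 1 - p.1 - p.2) = 0}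

/-- The contraction `f^l_i`. -/
def fmap (q : Fin 3 → E2) (l : ℕ) (i : ℕ × ℕ) (x : E2) : E2 :=
  q 0 + ((i.1 : ℝ) / l) • (q 1 - q 0) + ((i.2 : ℝ) / l) • (q 2 - q 0)
    + (l : ℝ)⁻¹ • (x - q 0)

/-- The closed equilateral triangle `△`. -/
def Tri (q : Fin 3 → E2) : Set E2 := convexHull ℝ (Set.range q)

def V0 (q : Fin 3 → E2) : Set E2 := Set.range q

/-- Words of length `n` (padded by `(0,0)` beyond position `n`). -/
def Wn (l : ℕ → ℕ) (n : ℕ) : Set (ℕ → ℕ × ℕ) :=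
  {w | (∀ k, k < n → w k ∈ Sset (l k)) ∧ ∀ k, n ≤ k → w k = (0, 0)}

/-- `wordMap q l w n = f^{l_1}_{w_1} ∘ ⋯ ∘ f^{l_n}_{w_n}` (0-indexed). -/
def wordMap (q : Fin 3 → E2) (l : ℕ → ℕ) (w : ℕ → ℕ × ℕ) : ℕ → E2 → E2
  | 0 => id
  | n + 1 => wordMap q l w n ∘ fmap q (l n) (w n)

/-- The thin scale irregular Sierpinski gasket `K`. -/
def Gasket (q : Fin 3 → E2) (l : ℕ → ℕ) : Set E2 :=
  ⋂ n, ⋃ w ∈ Wn l n, wordMap q l w n '' Tri q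

/-- The cell `K_w = K ∩ f_w(△)`. -/
def Cell (q : Fin 3 → E2) (l : ℕ → ℕ) (n : ℕ) (w : ℕ → ℕ × ℕ) : Set E2 :=
  Gasket q l ∩ wordMap q l w n '' Tri q

def Vn (q : Fin 3 → E2) (l : ℕ → ℕ) (n : ℕ) : Set E2 :=
  ⋃ w ∈ Wn l n, wordMap q l w n '' V0 q

def Vstar (q : Fin 3 → E2) (l : ℕ → ℕ) : Set E2 := ⋃ n, Vn q l n

def Ln (l : ℕ → ℕ) (n : ℕ) : ℕ := ∏ k ∈ Finset.range n, l k

def Mn (l : ℕ → ℕ) (n : ℕ) : ℕ := ∏ k ∈ Finset.range n, (3 * l k - 3)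

def rl (l : ℕ) : ℝ := (2 * (l : ℝ) / 3 + 1 / 9)⁻¹

def Rn (l : ℕ → ℕ) (n : ℕ) : ℝ := ∏ k ∈ Finset.range n, rl (l k)

def Tn (l : ℕ → ℕ) (n : ℕ) : ℝ := (Mn l n : ℝ) / Rn l n

/-- The basic energy form `E⁰` on `ℝ^{V₀}`. -/
def E0 (q : Fin 3 → E2) (u v : E2 → ℝ) : ℝ :=
  (1 / 2) * ∑ j : Fin 3, ∑ k : Fin 3, (u (q j) - u (q k)) * (v (q j) - v (q k))

/-- The level-`n` energy form `Eⁿ`. -/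
def En (q : Fin 3 → E2) (l : ℕ → ℕ) (n : ℕ) (u v : E2 → ℝ) : ℝ :=
  (Rn l n)⁻¹ * ∑ᶠ w ∈ Wn l n, E0 q (u ∘ wordMap q l w n) (v ∘ wordMap q l w n)

/-- The domain `F` of the limit resistance form. -/
def FDom (q : Fin 3 → E2) (l : ℕ → ℕ) : Set (E2 → ℝ) :=
  {u | ∃ C : ℝ, ∀ n, En q l n u u ≤ C}

/-- The limit form `E(u,v) = lim_n Eⁿ(u,v)`. -/
def EForm (q : Fin 3 → E2) (l : ℕ → ℕ) (u v : E2 → ℝ) : ℝ :=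
  limUnder atTop fun n => En q l n u v

/-- The intrinsic (geodesic) distance on `K`, with values in `ℝ≥0∞`. -/
def pdist (q : Fin 3 → E2) (l : ℕ → ℕ) (x y : E2) : ℝ≥0∞ :=
  ⨅ (γ : ℝ → E2) (_ : ContinuousOn γ (Set.Icc 0 1))
    (_ : Set.MapsTo γ (Set.Icc 0 1) (Gasket q l)) (_ : γ 0 = x) (_ : γ 1 = y),
    eVariationOn γ (Set.Icc 0 1)

def gdist (q : Fin 3 → E2) (l : ℕ → ℕ) (x y : E2) : ℝ := (pdist q l x y).toReal

/-- The set of resistance quotients used to define `R_E`. -/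
def REset (q : Fin 3 → E2) (l : ℕ → ℕ) (x y : E2) : Set ℝ :=
  {t | ∃ u ∈ FDom q l, 0 < EForm q l u u ∧ t = (u x - u y) ^ 2 / EForm q l u u}

/-- The resistance metric `R_E`. -/
def RE (q : Fin 3 → E2) (l : ℕ → ℕ) (x y : E2) : ℝ := sSup (REset q l x y)

/-- Resistance quotients over continuous representatives (i.e. `F` viewed in `C(K)`). -/
def REcSet (q : Fin 3 → E2) (l : ℕ → ℕ) (x y : E2) : Set ℝ :=
  {t | ∃ u ∈ FDom q l, ContinuousOn u (Gasket q l) ∧ 0 < EForm q l u u ∧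
    t = (u x - u y) ^ 2 / EForm q l u u}

def REc (q : Fin 3 → E2) (l : ℕ → ℕ) (x y : E2) : ℝ := sSup (REcSet q l x y)

/-- The open `d`-ball in `K`. -/
def Bd (q : Fin 3 → E2) (l : ℕ → ℕ) (x : E2) (s : ℝ) : Set E2 :=
  {y ∈ Gasket q l | gdist q l x y < s}

/-- The open `R_E`-ball in `K`. -/
def BRc (q : Fin 3 → E2) (l : ℕ → ℕ) (x : E2) (s : ℝ) : Set E2 :=
  {y ∈ Gasket q l | REc q l x y < s}

/-- `Λ^{(k)}_{n,w}`: words within `k` cell-steps of `w`. -/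
def Lam (q : Fin 3 → E2) (l : ℕ → ℕ) (n : ℕ) (w : ℕ → ℕ × ℕ) (k : ℕ) :
    Set (ℕ → ℕ × ℕ) :=
  {v ∈ Wn l n | ∃ c : ℕ → ℕ → ℕ × ℕ, c 0 = w ∧ c k = v ∧ (∀ j ≤ k, c j ∈ Wn l n) ∧
    ∀ j < k, (Cell q l n (c j) ∩ Cell q l n (c (j + 1))).Nonempty}

/-- `U^{(k)}_{n,w}`. -/
def Unwk (q : Fin 3 → E2) (l : ℕ → ℕ) (n : ℕ) (w : ℕ → ℕ × ℕ) (k : ℕ) : Set E2 :=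
  ⋃ v ∈ Lam q l n w k, Cell q l n v

def betaZero (l : ℕ → ℕ) : ℝ :=
  ⨅ n : ℕ, Real.logb (l n) (2 * (l n : ℝ) ^ 2 - (5 / 3) * (l n : ℝ) - 1 / 3)

def betaOne (l : ℕ → ℕ) : ℝ :=
  ⨆ n : ℕ, Real.logb (l n) (2 * (l n : ℝ) ^ 2 - (5 / 3) * (l n : ℝ) - 1 / 3)

def betaM (l : ℕ → ℕ) : ℝ := ⨅ n : ℕ, Real.logb (l n) (3 * (l n : ℝ) - 3)

def betaR (l : ℕ → ℕ) : ℝ := ⨆ n : ℕ, Real.logb (l n) ((rl (l n))⁻¹)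

/-- The value of `Ψ` on the interval `[1/L_{n+1}, 1/L_n]`. -/
def psiPiece (l : ℕ → ℕ) (n : ℕ) (s : ℝ) : ℝ :=
  (Tn l (n + 1))⁻¹
    * (1 + ((3 * (l n : ℝ) - 4) / ((l n : ℝ) - 1)) * ((Ln l (n + 1) : ℝ) * s - 1))
    * (1 + (((2 / 3) * (l n : ℝ) - 8 / 9) / ((l n : ℝ) - 1)) * ((Ln l (n + 1) : ℝ) * s - 1))

/-- `Ψ = Ψ_𝒍` is characterized by these defining clauses. -/
def IsPsi (l : ℕ → ℕ) (Psi : ℝ → ℝ) : Prop :=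
  (∀ n : ℕ, ∀ s : ℝ, ((Ln l (n + 1) : ℝ))⁻¹ ≤ s → s ≤ ((Ln l n : ℝ))⁻¹ →
      Psi s = psiPiece l n s) ∧
  (∀ s : ℝ, 1 ≤ s → Psi s = s ^ betaZero l) ∧ Psi 0 = 0

def psiMPiece (l : ℕ → ℕ) (n : ℕ) (s : ℝ) : ℝ :=
  ((Mn l (n + 1) : ℝ))⁻¹
    * (1 + ((3 * (l n : ℝ) - 4) / ((l n : ℝ) - 1)) * ((Ln l (n + 1) : ℝ) * s - 1))

def IsPsiM (l : ℕ → ℕ) (PsiM : ℝ → ℝ) : Prop :=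
  (∀ n : ℕ, ∀ s : ℝ, ((Ln l (n + 1) : ℝ))⁻¹ ≤ s → s ≤ ((Ln l n : ℝ))⁻¹ →
      PsiM s = psiMPiece l n s) ∧
  (∀ s : ℝ, 1 ≤ s → PsiM s = s ^ betaM l) ∧ PsiM 0 = 0

def psiRPiece (l : ℕ → ℕ) (n : ℕ) (s : ℝ) : ℝ :=
  Rn l (n + 1)
    * (1 + (((2 / 3) * (l n : ℝ) - 8 / 9) / ((l n : ℝ) - 1)) * ((Ln l (n + 1) : ℝ) * s - 1))

def IsPsiR (l : ℕ → ℕ) (PsiR : ℝ → ℝ) : Prop :=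
  (∀ n : ℕ, ∀ s : ℝ, ((Ln l (n + 1) : ℝ))⁻¹ ≤ s → s ≤ ((Ln l n : ℝ))⁻¹ →
      PsiR s = psiRPiece l n s) ∧
  (∀ s : ℝ, 1 ≤ s → PsiR s = s ^ betaR l) ∧ PsiR 0 = 0

/-- `μ` is the uniform distribution on `K`: a Borel measure carried by `K`
with `μ(K_w) = 1/M_{|w|}` for every word `w`. -/
def IsUnif (q : Fin 3 → E2) (l : ℕ → ℕ) (μ : Measure E2) : Prop :=
  μ (Gasket q l)ᶜ = 0 ∧ ∀ n : ℕ, ∀ w ∈ Wn l n, μ (Cell q l n w) = ((Mn l n : ℝ≥0∞))⁻¹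

/-- `μ` is the energy measure of `u`: a Borel measure carried by `K` with
`μ(K_w) = R_{|w|}⁻¹ E^{𝒍^{|w|}}(u∘F_w, u∘F_w)` for every word `w`. -/
def IsEnergyMeasure (q : Fin 3 → E2) (l : ℕ → ℕ) (u : E2 → ℝ) (μ : Measure E2) : Prop :=
  μ (Gasket q l)ᶜ = 0 ∧ ∀ n : ℕ, ∀ w ∈ Wn l n,
    μ (Cell q l n w) = ENNReal.ofReal ((Rn l n)⁻¹ *
      EForm q (fun k => l (k + n)) (u ∘ wordMap q l w n) (u ∘ wordMap q l w n))


/-! ### Elementary inequalities -/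

def T3 (x y z : ℝ) : ℝ := (x - y) ^ 2 + (x - z) ^ 2 + (y - z) ^ 2

lemma T3_nonneg (x y z : ℝ) : 0 ≤ T3 x y z := by unfold T3; positivity

lemma T3_ge (x y z : ℝ) : 3 / 2 * (x - y) ^ 2 ≤ T3 x y z := by
  unfold T3; nlinarith [sq_nonneg (x + y - 2 * z)]

lemma T3_ge' (x y z : ℝ) : 3 / 2 * (x - z) ^ 2 ≤ T3 x y z := by
  unfold T3; nlinarith [sq_nonneg (x + z - 2 * y)]

lemma T3_ge'' (x y z : ℝ) : 3 / 2 * (y - z) ^ 2 ≤ T3 x y z := by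
  unfold T3; nlinarith [sq_nonneg (y + z - 2 * x)]

lemma sg_ineq (a p q x s y : ℝ) :
    3 / 5 * T3 a x y ≤ T3 a p q + T3 p x s + T3 q s y := by
  unfold T3
  obtain ⟨p', hp⟩ : ∃ p', p = (2 * a + 2 * x + y) / 5 + p' := ⟨p - (2 * a + 2 * x + y) / 5, by ring⟩
  obtain ⟨q', hq⟩ : ∃ q', q = (2 * a + 2 * y + x) / 5 + q' := ⟨q - (2 * a + 2 * y + x) / 5, by ring⟩
  obtain ⟨s', hs⟩ : ∃ s', s = (2 * x + 2 * y + a) / 5 + s' := ⟨s - (2 * x + 2 * y + a) / 5, by ring⟩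
  subst hp hq hs
  nlinarith [sq_nonneg (p' - q'), sq_nonneg (p' - s'), sq_nonneg (q' - s'), sq_nonneg p',
    sq_nonneg q', sq_nonneg s']

lemma engel2 (A B α β : ℝ) (hα : 0 < α) (hβ : 0 < β) :
    (A + B) ^ 2 / (α + β) ≤ A ^ 2 / α + B ^ 2 / β := by
  rw [div_add_div _ _ hα.ne' hβ.ne', div_le_div_iff₀ (by positivity) (by positivity)]
  nlinarith [sq_nonneg (A * β - B * α), mul_pos hα hβ]

lemma T3_mean (x y z : ℝ) : T3 x y z = 3 * ((x - (x + y + z) / 3) ^ 2 +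
    (y - (x + y + z) / 3) ^ 2 + (z - (x + y + z) / 3) ^ 2) := by
  unfold T3; ring

lemma T3_le (x y z t : ℝ) : T3 x y z ≤ 3 * ((x - t) ^ 2 + (y - t) ^ 2 + (z - t) ^ 2) := by
  unfold T3; nlinarith [sq_nonneg (x + y + z - 3 * t)]

lemma side_ineq (c x y d m : ℝ) (hm : 0 < m) :
    (c - d) ^ 2 / (10 / 9 + 2 / 3 * m) ≤
      9 / 5 * (x - c) ^ 2 + 9 / 5 * (y - d) ^ 2 + 3 / 2 / m * (x - y) ^ 2 := by
  have h1 := engel2 (c - x) (y - d) (5 / 9) (5 / 9) (by norm_num) (by norm_num)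
  have h2 := engel2 ((c - x) + (y - d)) (x - y) (5 / 9 + 5 / 9) (2 / 3 * m) (by norm_num)
    (by positivity)
  have e1 : (c - x + (y - d) + (x - y)) = c - d := by ring
  rw [e1] at h2
  have e2 : (x - y) ^ 2 / (2 / 3 * m) = 3 / 2 / m * (x - y) ^ 2 := by field_simp
  rw [e2] at h2
  norm_num at h1 h2 ⊢
  nlinarith

lemma final_ineq (a0 a1 a2 x01 x02 x10 x12 x20 x21 m : ℝ) (hm : 0 < m) :
    9 / (6 * m + 25) * T3 a0 a1 a2 ≤
      3 / 5 * (T3 a0 x01 x02 + T3 a1 x10 x12 + T3 a2 x20 x21) +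
      3 / 2 / m * ((x01 - x10) ^ 2 + (x02 - x20) ^ 2 + (x12 - x21) ^ 2) := by
  rw [T3_mean a0 x01, T3_mean a1 x10, T3_mean a2 x20]
  generalize (a0 + x01 + x02) / 3 = c0
  generalize (a1 + x10 + x12) / 3 = c1
  generalize (a2 + x20 + x21) / 3 = c2
  have h1 := side_ineq c0 x01 x10 c1 m hm
  have h2 := side_ineq c0 x02 x20 c2 m hm
  have h3 := side_ineq c1 x12 x21 c2 m hm
  have h4 : ((c0 - c1) ^ 2 + (c0 - c2) ^ 2 + (c1 - c2) ^ 2) / (10 / 9 + 2 / 3 * m)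
      = T3 c0 c1 c2 / (10 / 9 + 2 / 3 * m) := rfl
  rw [T3_mean, add_div, add_div] at h4
  set c := (c0 + c1 + c2) / 3
  have k (a b : ℝ) : (a - c) ^ 2 * (27 / (6 * m + 25)) ≤
      9 / 5 * (a - b) ^ 2 + 3 * (b - c) ^ 2 / (10 / 9 + 2 / 3 * m) := by
    have := engel2 (a - b) (b - c) (5 / 9) ((10 / 9 + 2 / 3 * m) / 3) (by norm_num) (by positivity)
    have e1 : a - b + (b - c) = a - c := by ring
    rw [e1] at this
    have e2 : (a - c) ^ 2 * (27 / (6 * m + 25)) = (a - c) ^ 2 / (5 / 9 + (10 / 9 + 2 / 3 * m) / 3) := by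
      field_simp; ring
    have e3 : (b - c) ^ 2 / ((10 / 9 + 2 / 3 * m) / 3) = 3 * (b - c) ^ 2 / (10 / 9 + 2 / 3 * m) := by
      field_simp
    rw [e2]; rw [e3] at this
    linarith
  have k0 := k a0 c0
  have k1 := k a1 c1
  have k2 := k a2 c2
  have hT := T3_le a0 a1 a2 c
  have hT' := mul_le_mul_of_nonneg_left hT (show 0 ≤ 9 / (6 * m + 25) by positivity)
  have e : 9 / (6 * m + 25) * (3 * ((a0 - c) ^ 2 + (a1 - c) ^ 2 + (a2 - c) ^ 2)) =
    (a0 - c) ^ 2 * (27 / (6 * m + 25)) + (a1 - c) ^ 2 * (27 / (6 * m + 25)) +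
    (a2 - c) ^ 2 * (27 / (6 * m + 25)) := by ring
  have e4 : 3 * ((c0 - c) ^ 2 + (c1 - c) ^ 2 + (c2 - c) ^ 2) / (10 / 9 + 2 / 3 * m) =
    3 * (c0 - c) ^ 2 / (10 / 9 + 2 / 3 * m) + 3 * (c1 - c) ^ 2 / (10 / 9 + 2 / 3 * m) +
    3 * (c2 - c) ^ 2 / (10 / 9 + 2 / 3 * m) := by ring
  rw [e4] at h4
  linarith

lemma chain_ineq (h : ℕ → ℝ) (m : ℕ) (s : ℕ → ℝ) (hm : 0 < m)
    (hs : ∀ t < m, 3 / 2 * (h t - h (t + 1)) ^ 2 ≤ s t) :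
    3 / 2 / (m : ℝ) * (h 0 - h m) ^ 2 ≤ ∑ t ∈ Finset.range m, s t := by
  have h1 : h 0 - h m = ∑ t ∈ Finset.range m, (h t - h (t + 1)) :=
    (Finset.sum_range_sub' h m).symm
  have h2 := sq_sum_le_card_mul_sum_sq (s := Finset.range m) (f := fun t => h t - h (t + 1))
  rw [← h1, Finset.card_range] at h2
  have h3 : ∑ t ∈ Finset.range m, 3 / 2 * (h t - h (t + 1)) ^ 2 ≤ ∑ t ∈ Finset.range m, s t :=
    Finset.sum_le_sum fun t ht => hs t (Finset.mem_range.1 ht)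
  rw [← Finset.mul_sum] at h3
  have hm' : (0 : ℝ) < m := by exact_mod_cast hm
  refine le_trans ?_ h3
  rw [div_mul_eq_mul_div, div_le_iff₀ hm']
  nlinarith

/-! ### The finite index sets -/

lemma Sset_finite (l : ℕ) : (Sset l).Finite := by
  refine ((Finset.range (l + 1)) ×ˢ (Finset.range (l + 1))).finite_toSet.subset ?_
  rintro ⟨a, b⟩ ⟨h, -⟩
  simp only [Finset.coe_product, Finset.coe_range, mem_prod, mem_Iio] at h ⊢
  omega

def Sf (l : ℕ) : Finset (ℕ × ℕ) := (Sset_finite l).toFinset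

lemma mem_Sf {l : ℕ} {i : ℕ × ℕ} : i ∈ Sf l ↔ i ∈ Sset l := by simp [Sf]

def Tc (g : ℕ → ℕ → ℝ) (i : ℕ × ℕ) : ℝ :=
  T3 (g i.1 i.2) (g (i.1 + 1) i.2) (g i.1 (i.2 + 1))

lemma Tc_nonneg (g : ℕ → ℕ → ℝ) (i : ℕ × ℕ) : 0 ≤ Tc g i := T3_nonneg _ _ _

lemma sum_sub (m : ℕ) (hm : 1 ≤ m) (f : ℕ × ℕ → ℝ) (hf : ∀ i, 0 ≤ f i) :
    (f (0, 0) + f (1, 0) + f (0, 1)) + (f (m + 3, 0) + f (m + 2, 0) + f (m + 2, 1)) +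
    (f (0, m + 3) + f (0, m + 2) + f (1, m + 2)) +
    (∑ t ∈ Finset.range m, f (t + 2, 0) + ∑ t ∈ Finset.range m, f (0, t + 2) +
      ∑ t ∈ Finset.range m, f (m + 1 - t, t + 2)) ≤ ∑ i ∈ Sf (m + 4), f i := by
  classical
  set A : Finset (ℕ × ℕ) := {(0, 0), (1, 0), (0, 1), (m + 3, 0), (m + 2, 0), (m + 2, 1),
    (0, m + 3), (0, m + 2), (1, m + 2)} with hA
  set B0 := (Finset.range m).image (fun t => (t + 2, 0)) with hB0
  set B1 := (Finset.range m).image (fun t => (0, t + 2)) with hB1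
  set B2 := (Finset.range m).image (fun t => (m + 1 - t, t + 2)) with hB2
  have sA : ∑ i ∈ A, f i = (f (0, 0) + f (1, 0) + f (0, 1)) +
      (f (m + 3, 0) + f (m + 2, 0) + f (m + 2, 1)) +
      (f (0, m + 3) + f (0, m + 2) + f (1, m + 2)) := by
    rw [hA]
    repeat rw [Finset.sum_insert (by
      simp only [Finset.mem_insert, Finset.mem_singleton, Prod.mk.injEq]; omega)]
    rw [Finset.sum_singleton]; ring
  have s0 : ∑ i ∈ B0, f i = ∑ t ∈ Finset.range m, f (t + 2, 0) := by
    rw [hB0, Finset.sum_image]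
    intro a _ b _ h; simpa using h
  have s1 : ∑ i ∈ B1, f i = ∑ t ∈ Finset.range m, f (0, t + 2) := by
    rw [hB1, Finset.sum_image]
    intro a _ b _ h; simpa using h
  have s2 : ∑ i ∈ B2, f i = ∑ t ∈ Finset.range m, f (m + 1 - t, t + 2) := by
    rw [hB2, Finset.sum_image]
    intro a _ b _ h; simp at h; omega
  have d1 : Disjoint B0 B1 := by
    rw [Finset.disjoint_left]; rintro ⟨a, b⟩ h h'
    simp [hB0, hB1] at h h'; omega
  have d2 : Disjoint (B0 ∪ B1) B2 := by
    rw [Finset.disjoint_left]; rintro ⟨a, b⟩ h h'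
    simp [hB0, hB1, hB2] at h h'; omega
  have d3 : Disjoint A (B0 ∪ B1 ∪ B2) := by
    rw [Finset.disjoint_left]; rintro ⟨a, b⟩ h h'
    simp [hA, hB0, hB1, hB2] at h h'; omega
  have hsub : A ∪ (B0 ∪ B1 ∪ B2) ⊆ Sf (m + 4) := by
    rintro ⟨a, b⟩ h
    rw [mem_Sf]
    have e : m + 4 - 1 = m + 3 := by omega
    simp only [Sset, e, Set.mem_ofPred_eq]
    simp only [hA, hB0, hB1, hB2, Finset.mem_union, Finset.mem_insert, Finset.mem_singleton,
      Finset.mem_image, Finset.mem_range, Prod.mk.injEq] at h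
    refine ⟨by omega, ?_⟩
    simp only [mul_eq_zero]
    omega
  have := Finset.sum_le_sum_of_subset_of_nonneg (f := f) hsub (fun i _ _ => hf i)
  rw [Finset.sum_union d3, Finset.sum_union d2, Finset.sum_union d1, sA, s0, s1, s2] at this
  exact this

lemma mono_core (l : ℕ) (hl : 5 ≤ l) (g : ℕ → ℕ → ℝ) :
    rl l * T3 (g 0 0) (g l 0) (g 0 l) ≤ ∑ i ∈ Sf l, Tc g i := by
  obtain ⟨m, rfl⟩ : ∃ m, l = m + 4 := ⟨l - 4, by omega⟩
  have hm : 1 ≤ m := by omega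
  have hm' : (0 : ℝ) < m := by exact_mod_cast hm
  refine le_trans ?_ (sum_sub m hm (Tc g) (Tc_nonneg g))
  have c0 := sg_ineq (g 0 0) (g 1 0) (g 0 1) (g 2 0) (g 1 1) (g 0 2)
  have c1 := sg_ineq (g (m + 4) 0) (g (m + 3) 0) (g (m + 3) 1) (g (m + 2) 0) (g (m + 2) 1)
    (g (m + 2) 2)
  have c2 := sg_ineq (g 0 (m + 4)) (g 0 (m + 3)) (g 1 (m + 3)) (g 0 (m + 2)) (g 1 (m + 2))
    (g 2 (m + 2))
  have b0 := chain_ineq (fun t => g (t + 2) 0) m (fun t => Tc g (t + 2, 0)) (by omega)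
    (fun t _ => T3_ge _ _ _)
  have b1 := chain_ineq (fun t => g 0 (t + 2)) m (fun t => Tc g (0, t + 2)) (by omega)
    (fun t _ => T3_ge' _ _ _)
  have b2 := chain_ineq (fun t => g (m + 2 - t) (t + 2)) m (fun t => Tc g (m + 1 - t, t + 2))
    (by omega)
    (fun t ht => by
      have e1 : m + 2 - t = m + 1 - t + 1 := by omega
      have e2 : m + 2 - (t + 1) = m + 1 - t := by omega
      simp only [e1, e2]
      exact T3_ge'' _ _ _)
  have e1 : m + 2 - m = 2 := by omega
  simp only [e1, zero_add, Nat.sub_zero] at b0 b1 b2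
  have F := final_ineq (g 0 0) (g (m + 4) 0) (g 0 (m + 4)) (g 2 0) (g 0 2) (g (m + 2) 0)
    (g (m + 2) 2) (g 0 (m + 2)) (g 2 (m + 2)) m hm'
  have er : rl (m + 4) = 9 / (6 * m + 25) := by
    unfold rl; push_cast; field_simp; ring
  rw [er]
  have x1 : Tc g (0, 0) + Tc g (1, 0) + Tc g (0, 1) =
    T3 (g 0 0) (g 1 0) (g 0 1) + T3 (g 1 0) (g 2 0) (g 1 1) + T3 (g 0 1) (g 1 1) (g 0 2) := rfl
  have x2 : Tc g (m + 3, 0) + Tc g (m + 2, 0) + Tc g (m + 2, 1) =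
    T3 (g (m + 4) 0) (g (m + 3) 0) (g (m + 3) 1) + T3 (g (m + 3) 0) (g (m + 2) 0) (g (m + 2) 1) +
     T3 (g (m + 3) 1) (g (m + 2) 1) (g (m + 2) 2) := by
    simp only [Tc, T3, zero_add]; ring
  have x3 : Tc g (0, m + 3) + Tc g (0, m + 2) + Tc g (1, m + 2) =
    T3 (g 0 (m + 4)) (g 0 (m + 3)) (g 1 (m + 3)) + T3 (g 0 (m + 3)) (g 0 (m + 2)) (g 1 (m + 2)) +
     T3 (g 1 (m + 3)) (g 1 (m + 2)) (g 2 (m + 2)) := by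
    simp only [Tc, T3, zero_add]; ring
  rw [x1, x2, x3]
  linarith

/-- path estimate: one special cell, the rest has small energy. -/
lemma path_ineq (l : ℕ) (i : ℕ × ℕ) (hi : i ∈ Sf l) (f : ℕ × ℕ → ℝ) (hf : ∀ j, 0 ≤ f j)
    (h : ℕ → ℝ) (φ : ℕ → ℕ × ℕ) (hφ : ∀ t < l, φ t ∈ Sf l)
    (hinj : Set.InjOn φ (Finset.range l : Set ℕ))
    (hd : ∀ t < l, 3 / 2 * (h t - h (t + 1)) ^ 2 ≤ f (φ t)) :
    |h 0 - h l| ≤ √(2 / 3 * f i) + √(2 / 3 * l * (∑ j ∈ Sf l, f j - f i)) := by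
  classical
  have h1 : h 0 - h l = ∑ t ∈ Finset.range l, (h t - h (t + 1)) :=
    (Finset.sum_range_sub' h l).symm
  have hb : ∀ t < l, |h t - h (t + 1)| ≤ √(2 / 3 * f (φ t)) := fun t ht => by
    apply Real.abs_le_sqrt; linarith [hd t ht]
  have h2 : |h 0 - h l| ≤ ∑ t ∈ Finset.range l, √(2 / 3 * f (φ t)) := by
    rw [h1]
    exact (Finset.abs_sum_le_sum_abs _ _).trans
      (Finset.sum_le_sum fun t ht => hb t (Finset.mem_range.1 ht))
  refine h2.trans ?_
  have h3 : ∑ t ∈ Finset.range l, √(2 / 3 * f (φ t)) =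
      ∑ j ∈ (Finset.range l).image φ, √(2 / 3 * f j) := by
    rw [Finset.sum_image hinj]
  rw [h3]
  set P := (Finset.range l).image φ
  have hP : P.card ≤ l := by
    simpa using (Finset.card_image_le (s := Finset.range l) (f := φ))
  have hPS : P ⊆ Sf l := by
    intro j hj
    obtain ⟨t, ht, rfl⟩ := Finset.mem_image.1 hj
    exact hφ t (Finset.mem_range.1 ht)
  have h4 : ∑ j ∈ P, √(2 / 3 * f j) ≤ √(2 / 3 * f i) + ∑ j ∈ P.erase i, √(2 / 3 * f j) := by
    by_cases hiP : i ∈ P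
    · rw [Finset.add_sum_erase _ (fun j => √(2 / 3 * f j)) hiP]
    · rw [Finset.erase_eq_of_notMem hiP]
      linarith [Real.sqrt_nonneg (2 / 3 * f i)]
  refine h4.trans (add_le_add le_rfl ?_)
  apply Real.le_sqrt_of_sq_le
  refine sq_sum_le_card_mul_sum_sq.trans ?_
  have h5 : ∑ j ∈ P.erase i, √(2 / 3 * f j) ^ 2 = 2 / 3 * ∑ j ∈ P.erase i, f j := by
    rw [Finset.mul_sum]
    exact Finset.sum_congr rfl fun j _ => Real.sq_sqrt (by have := hf j; positivity)
  rw [h5]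
  have h6 : ∑ j ∈ P.erase i, f j ≤ ∑ j ∈ Sf l, f j - f i := by
    rw [← Finset.add_sum_erase _ f hi, add_sub_cancel_left]
    exact Finset.sum_le_sum_of_subset_of_nonneg (Finset.erase_subset_erase _ hPS)
      fun j _ _ => hf j
  have h7 : ((P.erase i).card : ℝ) ≤ l := by
    exact_mod_cast (Finset.card_le_card (Finset.erase_subset _ _)).trans hP
  have h8 : 0 ≤ ∑ j ∈ P.erase i, f j := Finset.sum_nonneg fun j _ => hf j
  calc ((P.erase i).card : ℝ) * (2 / 3 * ∑ j ∈ P.erase i, f j)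
      ≤ l * (2 / 3 * (∑ j ∈ Sf l, f j - f i)) := by gcongr
    _ = _ := by ring

lemma key_core (l : ℕ) (hl : 5 ≤ l) (g : ℕ → ℕ → ℝ) (i : ℕ × ℕ) (hi : i ∈ Sf l) :
    T3 (g 0 0) (g l 0) (g 0 l) ≤
      3 * (√(2 / 3 * Tc g i) + √(2 / 3 * l * (∑ j ∈ Sf l, Tc g j - Tc g i))) ^ 2 := by
  have p0 := path_ineq l i hi (Tc g) (Tc_nonneg g) (fun t => g t 0) (fun t => (t, 0))
    (fun t ht => by rw [mem_Sf]; simp [Sset]; omega) (fun a _ b _ h => by simpa using h)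
    (fun t _ => T3_ge _ _ _)
  have p1 := path_ineq l i hi (Tc g) (Tc_nonneg g) (fun t => g 0 t) (fun t => (0, t))
    (fun t ht => by rw [mem_Sf]; simp [Sset]; omega) (fun a _ b _ h => by simpa using h)
    (fun t _ => T3_ge' _ _ _)
  have p2 := path_ineq l i hi (Tc g) (Tc_nonneg g) (fun t => g (l - t) t)
    (fun t => (l - 1 - t, t))
    (fun t ht => by
      rw [mem_Sf]; simp only [Sset, Set.mem_ofPred_eq, mul_eq_zero]; omega)
    (fun a _ b _ h => by simp at h; omega)
    (fun t ht => by
      have e1 : l - t = l - 1 - t + 1 := by omega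
      have e2 : l - (t + 1) = l - 1 - t := by omega
      simp only [e1, e2]
      exact T3_ge'' _ _ _)
  simp only [Nat.sub_zero, Nat.sub_self] at p2
  set M := √(2 / 3 * Tc g i) + √(2 / 3 * l * (∑ j ∈ Sf l, Tc g j - Tc g i))
  have q0 := sq_le_sq' (neg_le_of_abs_le p0) (le_of_abs_le p0)
  have q1 := sq_le_sq' (neg_le_of_abs_le p1) (le_of_abs_le p1)
  have q2 := sq_le_sq' (neg_le_of_abs_le p2) (le_of_abs_le p2)
  unfold T3
  linarith

/-! ### Words -/

lemma Wn_finite (l : ℕ → ℕ) (n : ℕ) : (Wn l n).Finite := by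
  classical
  have hS : (Set.pi (Set.univ : Set (Fin n)) fun k => Sset (l k)).Finite :=
    Set.Finite.pi fun k => Sset_finite (l k)
  refine (hS.image (fun v : Fin n → ℕ × ℕ => fun k : ℕ =>
    if h : k < n then v ⟨k, h⟩ else (0, 0))).subset ?_
  intro w hw
  refine ⟨fun k => w k, fun k _ => hw.1 k k.2, ?_⟩
  funext k
  by_cases h : k < n
  · simp [h]
  · simp only [h, dite_false]; exact (hw.2 k (not_lt.1 h)).symm

def Wf (l : ℕ → ℕ) (n : ℕ) : Finset (ℕ → ℕ × ℕ) := (Wn_finite l n).toFinset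

lemma mem_Wf {l : ℕ → ℕ} {n : ℕ} {w : ℕ → ℕ × ℕ} : w ∈ Wf l n ↔ w ∈ Wn l n := by simp [Wf]

lemma Wf_zero (l : ℕ → ℕ) : Wf l 0 = {fun _ => (0, 0)} := by
  ext w
  simp only [mem_Wf, Wn, Finset.mem_singleton, Set.mem_ofPred_eq]
  constructor
  · intro h; funext k; exact h.2 k (Nat.zero_le _)
  · rintro rfl; simp

lemma update_mem {l : ℕ → ℕ} {n : ℕ} {w : ℕ → ℕ × ℕ} {i : ℕ × ℕ} (hw : w ∈ Wf l n)
    (hi : i ∈ Sf (l n)) : Function.update w n i ∈ Wf l (n + 1) := by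
  rw [mem_Wf] at *
  rw [mem_Sf] at hi
  refine ⟨fun k hk => ?_, fun k hk => ?_⟩
  · rcases Nat.lt_succ_iff_lt_or_eq.1 hk with h | rfl
    · rw [Function.update_of_ne h.ne]; exact hw.1 k h
    · rw [Function.update_self]; exact hi
  · rw [Function.update_of_ne (by omega)]; exact hw.2 k (by omega)

lemma parent_mem {l : ℕ → ℕ} {n : ℕ} {w : ℕ → ℕ × ℕ} (hw : w ∈ Wf l (n + 1)) :
    Function.update w n (0, 0) ∈ Wf l n := by
  rw [mem_Wf] at *
  refine ⟨fun k hk => ?_, fun k hk => ?_⟩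
  · rw [Function.update_of_ne (by omega)]; exact hw.1 k (by omega)
  · rcases eq_or_ne k n with rfl | h
    · rw [Function.update_self]
    · rw [Function.update_of_ne h]; exact hw.2 k (by omega)

lemma last_mem {l : ℕ → ℕ} {n : ℕ} {w : ℕ → ℕ × ℕ} (hw : w ∈ Wf l (n + 1)) :
    w n ∈ Sf (l n) := by
  rw [mem_Wf] at hw; rw [mem_Sf]; exact hw.1 n (by omega)

lemma sum_Wf_succ {M : Type*} [AddCommMonoid M] (l : ℕ → ℕ) (n : ℕ) (g : (ℕ → ℕ × ℕ) → M) :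
    ∑ w ∈ Wf l (n + 1), g w = ∑ w ∈ Wf l n, ∑ i ∈ Sf (l n), g (Function.update w n i) := by
  rw [← Finset.sum_product']
  refine Finset.sum_nbij' (fun w => (Function.update w n (0, 0), w n))
    (fun p => Function.update p.1 n p.2) ?_ ?_ ?_ ?_ ?_
  · intro w hw
    exact Finset.mem_product.2 ⟨parent_mem hw, last_mem hw⟩
  · rintro ⟨w, i⟩ h
    exact update_mem (Finset.mem_product.1 h).1 (Finset.mem_product.1 h).2
  · intro w _; simp
  · rintro ⟨w, i⟩ h
    have hw := mem_Wf.1 (Finset.mem_product.1 h).1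
    have := hw.2 n le_rfl
    simp [← this]
  · intro w _; simp

def consW (i : ℕ × ℕ) (w : ℕ → ℕ × ℕ) : ℕ → ℕ × ℕ
  | 0 => i
  | k + 1 => w k

lemma sum_Wf_cons {M : Type*} [AddCommMonoid M] (l : ℕ → ℕ) (n : ℕ) (g : (ℕ → ℕ × ℕ) → M) :
    ∑ w ∈ Wf l (n + 1), g w =
      ∑ i ∈ Sf (l 0), ∑ w ∈ Wf (fun k => l (k + 1)) n, g (consW i w) := by
  rw [← Finset.sum_product']
  refine Finset.sum_nbij' (fun w => (w 0, fun k => w (k + 1)))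
    (fun p => consW p.1 p.2) ?_ ?_ ?_ ?_ ?_
  · intro w hw
    rw [mem_Wf] at hw
    refine Finset.mem_product.2 ⟨mem_Sf.2 (hw.1 0 (by omega)), mem_Wf.2 ⟨fun k hk => ?_,
      fun k hk => ?_⟩⟩
    · exact hw.1 (k + 1) (by omega)
    · exact hw.2 (k + 1) (by omega)
  · rintro ⟨i, w⟩ h
    have h1 := mem_Sf.1 (Finset.mem_product.1 h).1
    have h2 := mem_Wf.1 (Finset.mem_product.1 h).2
    refine mem_Wf.2 ⟨fun k hk => ?_, fun k hk => ?_⟩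
    · cases k with
      | zero => exact h1
      | succ k => exact h2.1 k (by omega)
    · cases k with
      | zero => omega
      | succ k => exact h2.2 k (by omega)
  · intro w _; funext k; cases k <;> rfl
  · rintro ⟨i, w⟩ h; rfl
  · intro w _; congr 1; funext k; cases k <;> rfl

lemma wordMap_congr (q : Fin 3 → E2) (l : ℕ → ℕ) {w w' : ℕ → ℕ × ℕ} (n : ℕ)
    (h : ∀ k < n, w k = w' k) : wordMap q l w n = wordMap q l w' n := by
  induction n with
  | zero => rfl
  | succ n ih =>
    simp only [wordMap]
    rw [ih fun k hk => h k (by omega), h n (by omega)]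

lemma wordMap_update_same (q : Fin 3 → E2) (l : ℕ → ℕ) (w : ℕ → ℕ × ℕ) (n : ℕ) (i : ℕ × ℕ) :
    wordMap q l (Function.update w n i) n = wordMap q l w n :=
  wordMap_congr q l n fun k hk => Function.update_of_ne (by omega) _ _

lemma wordMap_update (q : Fin 3 → E2) (l : ℕ → ℕ) (w : ℕ → ℕ × ℕ) (n : ℕ) (i : ℕ × ℕ) :
    wordMap q l (Function.update w n i) (n + 1) = wordMap q l w n ∘ fmap q (l n) i := by
  simp only [wordMap, Function.update_self]
  rw [wordMap_update_same]

lemma wordMap_cons (q : Fin 3 → E2) (l : ℕ → ℕ) (w : ℕ → ℕ × ℕ) (n : ℕ) (i : ℕ × ℕ) :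
    wordMap q l (consW i w) (n + 1) = fmap q (l 0) i ∘ wordMap q (fun k => l (k + 1)) w n := by
  induction n with
  | zero => rfl
  | succ n ih =>
    rw [wordMap, ih]; rfl

/-! ### Energies -/

lemma E0_eq (q : Fin 3 → E2) (v : E2 → ℝ) : E0 q v v = T3 (v (q 0)) (v (q 1)) (v (q 2)) := by
  simp only [E0, Fin.sum_univ_three, T3]; ring

lemma E0_nonneg (q : Fin 3 → E2) (v : E2 → ℝ) : 0 ≤ E0 q v v := by
  rw [E0_eq]; exact T3_nonneg _ _ _

def latt (q : Fin 3 → E2) (l : ℕ) (v : E2 → ℝ) (a b : ℕ) : ℝ :=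
  v (q 0 + ((a : ℝ) / l) • (q 1 - q 0) + ((b : ℝ) / l) • (q 2 - q 0))

lemma E0_fmap (q : Fin 3 → E2) (l : ℕ) (v : E2 → ℝ) (i : ℕ × ℕ) :
    E0 q (v ∘ fmap q l i) (v ∘ fmap q l i) = Tc (latt q l v) i := by
  rw [E0_eq, Tc]
  simp only [latt, Function.comp, fmap]
  congr 2
  · simp
  · push_cast; rw [add_div, add_smul, one_div]; abel
  · push_cast; rw [add_div, add_smul, one_div]; abel

lemma E0_latt (q : Fin 3 → E2) (l : ℕ) (hl : 5 ≤ l) (v : E2 → ℝ) :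
    E0 q v v = T3 (latt q l v 0 0) (latt q l v l 0) (latt q l v 0 l) := by
  have : (l : ℝ) ≠ 0 := by positivity
  rw [E0_eq]
  simp [latt, this]

lemma E0_mono (q : Fin 3 → E2) (l : ℕ) (hl : 5 ≤ l) (v : E2 → ℝ) :
    rl l * E0 q v v ≤ ∑ i ∈ Sf l, E0 q (v ∘ fmap q l i) (v ∘ fmap q l i) := by
  rw [E0_latt q l hl]
  simp only [E0_fmap]
  exact mono_core l hl _

lemma E0_key (q : Fin 3 → E2) (l : ℕ) (hl : 5 ≤ l) (v : E2 → ℝ) (i : ℕ × ℕ) (hi : i ∈ Sf l) :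
    E0 q v v ≤ 3 * (√(2 / 3 * E0 q (v ∘ fmap q l i) (v ∘ fmap q l i)) +
      √(2 / 3 * l * (∑ j ∈ Sf l, E0 q (v ∘ fmap q l j) (v ∘ fmap q l j) -
        E0 q (v ∘ fmap q l i) (v ∘ fmap q l i)))) ^ 2 := by
  rw [E0_latt q l hl]
  simp only [E0_fmap]
  exact key_core l hl _ i hi

lemma rl_pos (l : ℕ) : 0 < rl l := by unfold rl; positivity

lemma Rn_pos (l : ℕ → ℕ) (n : ℕ) : 0 < Rn l n := Finset.prod_pos fun k _ => rl_pos _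

lemma Rn_succ (l : ℕ → ℕ) (n : ℕ) : Rn l (n + 1) = Rn l n * rl (l n) :=
  Finset.prod_range_succ _ _

lemma Rn_cons (l : ℕ → ℕ) (n : ℕ) : Rn l (n + 1) = Rn (fun k => l (k + 1)) n * rl (l 0) :=
  Finset.prod_range_succ' _ _

lemma En_eq (q : Fin 3 → E2) (l : ℕ → ℕ) (n : ℕ) (v : E2 → ℝ) :
    En q l n v v =
      (Rn l n)⁻¹ * ∑ w ∈ Wf l n, E0 q (v ∘ wordMap q l w n) (v ∘ wordMap q l w n) := by
  rw [En, finsum_mem_eq_finite_toFinset_sum _ (Wn_finite l n)]; rfl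

lemma En_zero (q : Fin 3 → E2) (l : ℕ → ℕ) (v : E2 → ℝ) : En q l 0 v v = E0 q v v := by
  rw [En_eq, Wf_zero]; simp [Rn, wordMap]

lemma En_mono (q : Fin 3 → E2) (l : ℕ → ℕ) (hl : ∀ n, 5 ≤ l n) (v : E2 → ℝ) :
    Monotone fun n => En q l n v v := by
  refine monotone_nat_of_le_succ fun n => ?_
  simp only [En_eq]
  rw [sum_Wf_succ, Rn_succ, mul_inv, mul_assoc]
  refine mul_le_mul_of_nonneg_left ?_ (inv_nonneg.2 (Rn_pos l n).le)
  rw [Finset.mul_sum]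
  refine Finset.sum_le_sum fun w _ => ?_
  simp only [wordMap_update]
  rw [inv_mul_eq_div, le_div_iff₀ (rl_pos _), mul_comm]
  exact E0_mono q (l n) (hl n) (v ∘ wordMap q l w n)

lemma En_cons (q : Fin 3 → E2) (l : ℕ → ℕ) (n : ℕ) (v : E2 → ℝ) :
    En q l (n + 1) v v = (rl (l 0))⁻¹ * ∑ i ∈ Sf (l 0),
      En q (fun k => l (k + 1)) n (v ∘ fmap q (l 0) i) (v ∘ fmap q (l 0) i) := by
  simp only [En_eq]
  rw [sum_Wf_cons, Rn_cons, mul_inv, mul_comm (Rn _ _)⁻¹, mul_assoc, ← Finset.mul_sum]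
  simp only [wordMap_cons]
  rfl

/-! ### Cell masses -/

def eC (q : Fin 3 → E2) (l : ℕ → ℕ) (u : E2 → ℝ) (n : ℕ) (w : ℕ → ℕ × ℕ) (k : ℕ) : ℝ :=
  (Rn l n)⁻¹ * En q (fun k => l (k + n)) k (u ∘ wordMap q l w n) (u ∘ wordMap q l w n)

def mC (q : Fin 3 → E2) (l : ℕ → ℕ) (u : E2 → ℝ) (n : ℕ) (w : ℕ → ℕ × ℕ) : ℝ :=
  (Rn l n)⁻¹ * EForm q (fun k => l (k + n)) (u ∘ wordMap q l w n) (u ∘ wordMap q l w n)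

def dC (q : Fin 3 → E2) (l : ℕ → ℕ) (u : E2 → ℝ) (n : ℕ) (w : ℕ → ℕ × ℕ) : ℝ :=
  (Rn l n)⁻¹ * E0 q (u ∘ wordMap q l w n) (u ∘ wordMap q l w n)

lemma eC_zero (q : Fin 3 → E2) (l : ℕ → ℕ) (u : E2 → ℝ) (n : ℕ) (w : ℕ → ℕ × ℕ) :
    eC q l u n w 0 = dC q l u n w := by rw [eC, En_zero, dC]

lemma dC_nonneg (q : Fin 3 → E2) (l : ℕ → ℕ) (u : E2 → ℝ) (n : ℕ) (w : ℕ → ℕ × ℕ) :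
    0 ≤ dC q l u n w := mul_nonneg (inv_nonneg.2 (Rn_pos _ _).le) (E0_nonneg _ _)

lemma eC_mono (q : Fin 3 → E2) (l : ℕ → ℕ) (hl : ∀ n, 5 ≤ l n) (u : E2 → ℝ) (n : ℕ)
    (w : ℕ → ℕ × ℕ) : Monotone (eC q l u n w) := fun a b h =>
  mul_le_mul_of_nonneg_left (En_mono q _ (fun k => hl (k + n)) _ h) (inv_nonneg.2 (Rn_pos _ _).le)

lemma eC_nonneg (q : Fin 3 → E2) (l : ℕ → ℕ) (hl : ∀ n, 5 ≤ l n) (u : E2 → ℝ) (n : ℕ)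
    (w : ℕ → ℕ × ℕ) (k : ℕ) : 0 ≤ eC q l u n w k :=
  ((eC_zero q l u n w).symm ▸ dC_nonneg q l u n w).trans (eC_mono q l hl u n w (Nat.zero_le k))

lemma eC_succ (q : Fin 3 → E2) (l : ℕ → ℕ) (u : E2 → ℝ) (n : ℕ) (w : ℕ → ℕ × ℕ) (k : ℕ) :
    eC q l u n w (k + 1) = ∑ i ∈ Sf (l n), eC q l u (n + 1) (Function.update w n i) k := by
  simp only [eC]
  rw [En_cons, Rn_succ, mul_inv, ← Finset.mul_sum, mul_assoc]
  simp only [wordMap_update, Nat.zero_add]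
  have : (fun k => l (k + 1 + n)) = fun k => l (k + (n + 1)) := by
    funext k; congr 1; omega
  rw [this]; rfl

lemma eC_sum (q : Fin 3 → E2) (l : ℕ → ℕ) (u : E2 → ℝ) (n k : ℕ) :
    ∑ w ∈ Wf l n, eC q l u n w k = En q l (n + k) u u := by
  induction n generalizing k with
  | zero => rw [Wf_zero]; simp [eC, Rn, wordMap]
  | succ n ih =>
    rw [sum_Wf_succ]
    simp only [← eC_succ]
    rw [ih]; congr 1; omega

lemma eC_tendsto (q : Fin 3 → E2) (l : ℕ → ℕ) (hl : ∀ n, 5 ≤ l n) (u : E2 → ℝ)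
    (hu : u ∈ FDom q l) (n : ℕ) (w : ℕ → ℕ × ℕ) (hw : w ∈ Wf l n) :
    Tendsto (eC q l u n w) atTop (nhds (mC q l u n w)) := by
  obtain ⟨C, hC⟩ := hu
  have hR := Rn_pos l n
  have hb : ∀ k, eC q l u n w k ≤ C := fun k =>
    (Finset.single_le_sum (f := fun w => eC q l u n w k)
      (fun w _ => eC_nonneg q l hl u n w k) hw).trans ((eC_sum q l u n k).le.trans (hC _))
  have h1 : BddAbove (Set.range (fun k => En q (fun k => l (k + n)) k (u ∘ wordMap q l w n)
      (u ∘ wordMap q l w n))) := by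
    refine ⟨Rn l n * C, ?_⟩
    rintro _ ⟨k, rfl⟩
    have := hb k
    rw [eC, inv_mul_le_iff₀ hR] at this
    exact this
  have h2 := tendsto_atTop_ciSup
    (En_mono q (fun k => l (k + n)) (fun k => hl (k + n)) (u ∘ wordMap q l w n)) h1
  have h3 := h2.limUnder_eq
  refine Tendsto.const_mul _ ?_
  rw [EForm, h3]; exact h2

section
variable {q : Fin 3 → E2} {l : ℕ → ℕ} {u : E2 → ℝ}

lemma dC_le_mC (hl : ∀ n, 5 ≤ l n) (hu : u ∈ FDom q l) {n : ℕ} {w : ℕ → ℕ × ℕ}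
    (hw : w ∈ Wf l n) : dC q l u n w ≤ mC q l u n w := by
  rw [← eC_zero]
  exact (eC_mono q l hl u n w).ge_of_tendsto (eC_tendsto q l hl u hu n w hw) 0

lemma mC_nonneg (hl : ∀ n, 5 ≤ l n) (hu : u ∈ FDom q l) {n : ℕ} {w : ℕ → ℕ × ℕ}
    (hw : w ∈ Wf l n) : 0 ≤ mC q l u n w := (dC_nonneg q l u n w).trans (dC_le_mC hl hu hw)

lemma mC_succ (hl : ∀ n, 5 ≤ l n) (hu : u ∈ FDom q l) {n : ℕ} {w : ℕ → ℕ × ℕ}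
    (hw : w ∈ Wf l n) :
    mC q l u n w = ∑ i ∈ Sf (l n), mC q l u (n + 1) (Function.update w n i) := by
  have h1 := (tendsto_add_atTop_iff_nat 1).2 (eC_tendsto q l hl u hu n w hw)
  simp only [eC_succ] at h1
  refine tendsto_nhds_unique h1 (tendsto_finsetSum _ fun i hi => ?_)
  exact eC_tendsto q l hl u hu (n + 1) _ (update_mem hw hi)

def totE (q : Fin 3 → E2) (l : ℕ → ℕ) (u : E2 → ℝ) : ℝ := EForm q l u u

lemma mC_sum (hl : ∀ n, 5 ≤ l n) (hu : u ∈ FDom q l) (n : ℕ) :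
    ∑ w ∈ Wf l n, mC q l u n w = totE q l u := by
  induction n with
  | zero => rw [Wf_zero]; simp [mC, Rn, wordMap, totE]
  | succ n ih =>
    rw [sum_Wf_succ, ← ih]
    exact Finset.sum_congr rfl fun w hw => (mC_succ hl hu hw).symm

lemma dC_sum_tendsto (hl : ∀ n, 5 ≤ l n) (hu : u ∈ FDom q l) :
    Tendsto (fun n => ∑ w ∈ Wf l n, dC q l u n w) atTop (nhds (totE q l u)) := by
  have h := eC_tendsto q l hl u hu 0 (fun _ => (0, 0)) (by simp [Wf_zero])
  have e : mC q l u 0 (fun _ => (0, 0)) = totE q l u := by simp [mC, Rn, wordMap, totE]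
  rw [e] at h
  refine h.congr fun n => ?_
  simp only [← eC_zero]
  rw [eC_sum]
  simp [eC, Rn, wordMap]

lemma dC_key (hl : ∀ n, 5 ≤ l n) (hu : u ∈ FDom q l) {n : ℕ} {w : ℕ → ℕ × ℕ} (hw : w ∈ Wf l n)
    {i : ℕ × ℕ} (hi : i ∈ Sf (l n)) :
    dC q l u n w ≤ 3 * (√(6 / 31 * mC q l u (n + 1) (Function.update w n i)) +
      √(mC q l u n w - mC q l u (n + 1) (Function.update w n i))) ^ 2 := by
  classical
  have hR := Rn_pos l n
  have hr := rl_pos (l n)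
  set v := u ∘ wordMap q l w n with hv
  have hk := E0_key q (l n) (hl n) v i hi
  set e : ℕ × ℕ → ℝ := fun j => E0 q (v ∘ fmap q (l n) j) (v ∘ fmap q (l n) j) with he
  have hd : ∀ j, e j = (Rn l n * rl (l n)) * dC q l u (n + 1) (Function.update w n j) := by
    intro j
    rw [dC, Rn_succ, wordMap_update, mul_inv_cancel_left₀ (by positivity)]
    rfl
  have hle : ∀ j ∈ Sf (l n), e j ≤
      (Rn l n * rl (l n)) * mC q l u (n + 1) (Function.update w n j) := fun j hj => by
    rw [hd]
    exact mul_le_mul_of_nonneg_left (dC_le_mC hl hu (update_mem hw hj)) (by positivity)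
  have h5 : (5 : ℝ) ≤ l n := by exact_mod_cast hl n
  have hr1 : rl (l n) ≤ 9 / 31 := by
    unfold rl; rw [inv_le_comm₀ (by positivity) (by norm_num)]; linarith
  have hr2 : 2 / 3 * (l n : ℝ) * rl (l n) ≤ 1 := by
    unfold rl; rw [mul_inv_le_iff₀ (by positivity)]; linarith
  have hmi := mC_nonneg hl hu (update_mem hw hi)
  have a1 : 2 / 3 * e i ≤ Rn l n * (6 / 31 * mC q l u (n + 1) (Function.update w n i)) := by
    have := hle i hi
    have : Rn l n * rl (l n) * mC q l u (n + 1) (Function.update w n i) ≤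
      Rn l n * (9 / 31) * mC q l u (n + 1) (Function.update w n i) := by gcongr
    linarith
  have a2 : ∑ j ∈ Sf (l n), e j - e i ≤
      (Rn l n * rl (l n)) * (mC q l u n w - mC q l u (n + 1) (Function.update w n i)) := by
    rw [mC_succ hl hu hw, ← Finset.add_sum_erase _ e hi,
      ← Finset.add_sum_erase _ (fun j => mC q l u (n + 1) (Function.update w n j)) hi,
      add_sub_cancel_left, add_sub_cancel_left, Finset.mul_sum]
    exact Finset.sum_le_sum fun j hj => hle j (Finset.mem_of_mem_erase hj)
  have hmd : 0 ≤ mC q l u n w - mC q l u (n + 1) (Function.update w n i) := by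
    rw [mC_succ hl hu hw, sub_nonneg]
    exact Finset.single_le_sum (f := fun j => mC q l u (n + 1) (Function.update w n j))
      (fun j hj => mC_nonneg hl hu (update_mem hw hj)) hi
  have a3 : 2 / 3 * (l n : ℝ) * (∑ j ∈ Sf (l n), e j - e i) ≤
      Rn l n * (mC q l u n w - mC q l u (n + 1) (Function.update w n i)) := by
    calc 2 / 3 * (l n : ℝ) * (∑ j ∈ Sf (l n), e j - e i) ≤ 2 / 3 * (l n : ℝ) *
          ((Rn l n * rl (l n)) * (mC q l u n w - mC q l u (n + 1) (Function.update w n i))) := by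
          gcongr
      _ = (2 / 3 * (l n : ℝ) * rl (l n)) * (Rn l n *
          (mC q l u n w - mC q l u (n + 1) (Function.update w n i))) := by ring
      _ ≤ 1 * (Rn l n * (mC q l u n w - mC q l u (n + 1) (Function.update w n i))) := by
          gcongr
      _ = _ := one_mul _
  have b1 := Real.sqrt_le_sqrt a1
  have b3 := Real.sqrt_le_sqrt a3
  rw [Real.sqrt_mul hR.le] at b1 b3
  have hk2 : E0 q v v ≤ 3 * (√(Rn l n) * √(6 / 31 * mC q l u (n + 1) (Function.update w n i)) +
      √(Rn l n) * √(mC q l u n w - mC q l u (n + 1) (Function.update w n i))) ^ 2 := by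
    refine hk.trans ?_
    gcongr
  rw [dC, inv_mul_le_iff₀ hR]
  refine hk2.trans (le_of_eq ?_)
  rw [← mul_add, mul_pow, Real.sq_sqrt hR.le]; ring

end

/-! ### Masses of cells tend to zero uniformly -/

section
variable {q : Fin 3 → E2} {l : ℕ → ℕ} {u : E2 → ℝ}

lemma zero_mem_Wf (hl : ∀ n, 5 ≤ l n) (n : ℕ) : (fun _ => (0, 0)) ∈ Wf l n := by
  rw [mem_Wf]
  exact ⟨fun k _ => by simp [Sset], fun _ _ => rfl⟩

lemma mC_le_parent (hl : ∀ n, 5 ≤ l n) (hu : u ∈ FDom q l) {n : ℕ} {w : ℕ → ℕ × ℕ}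
    (hw : w ∈ Wf l (n + 1)) : mC q l u (n + 1) w ≤ mC q l u n (Function.update w n (0, 0)) := by
  rw [mC_succ hl hu (parent_mem hw)]
  simp only [Function.update_idem]
  have := Finset.single_le_sum (f := fun j => mC q l u (n + 1) (Function.update w n j))
      (fun j hj => mC_nonneg hl hu
        (by have := update_mem (parent_mem hw) hj; rwa [Function.update_idem] at this))
      (last_mem hw)
  simpa using this

lemma mC_uniform (hl : ∀ n, 5 ≤ l n) (hu : u ∈ FDom q l) (ε : ℝ) (hε : 0 < ε) :
    ∃ N, ∀ n ≥ N, ∀ w ∈ Wf l n, mC q l u n w < ε := by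
  have hne : ∀ n, (Wf l n).Nonempty := fun n => ⟨_, zero_mem_Wf hl n⟩
  set s : ℕ → ℝ := fun n => (Wf l n).sup' (hne n) (mC q l u n) with hs
  have hle : ∀ n, ∀ w ∈ Wf l n, mC q l u n w ≤ s n := fun n w hw => Finset.le_sup' _ hw
  have hs0 : ∀ n, 0 ≤ s n := fun n =>
    (mC_nonneg hl hu (zero_mem_Wf hl n)).trans (hle n _ (zero_mem_Wf hl n))
  have hanti : Antitone s := by
    refine antitone_nat_of_succ_le fun n => ?_
    refine Finset.sup'_le _ _ fun w hw => ?_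
    exact (mC_le_parent hl hu hw).trans (hle n _ (parent_mem hw))
  have hlim := tendsto_atTop_ciInf hanti ⟨0, by rintro _ ⟨n, rfl⟩; exact hs0 n⟩
  set a := ⨅ n, s n
  have ha : 0 ≤ a := ge_of_tendsto' hlim hs0
  have hlim1 : Tendsto (fun n => s (n + 1)) atTop (nhds a) := (tendsto_add_atTop_iff_nat 1).2 hlim
  have hineq : ∀ n, s (n + 1) - (totE q l u - ∑ w ∈ Wf l n, dC q l u n w) ≤
      3 * (√(6 / 31 * s (n + 1)) + √(s n - s (n + 1))) ^ 2 := by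
    intro n
    obtain ⟨w, hw, hws⟩ := Finset.exists_mem_eq_sup' (hne (n + 1)) (mC q l u (n + 1))
    set p := Function.update w n (0, 0) with hp
    have hpm : p ∈ Wf l n := parent_mem hw
    have hk := dC_key hl hu hpm (last_mem hw)
    have e : Function.update p n (w n) = w := by simp [hp]
    rw [e, ← hws] at hk
    have h1 : mC q l u n p - dC q l u n p ≤ totE q l u - ∑ w ∈ Wf l n, dC q l u n w := by
      rw [← mC_sum hl hu n, ← Finset.sum_sub_distrib]
      exact Finset.single_le_sum (f := fun w => mC q l u n w - dC q l u n w)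
        (fun w hw => sub_nonneg.2 (dC_le_mC hl hu hw)) hpm
    have h2 : s (n + 1) ≤ mC q l u n p := by
      show (Wf l (n + 1)).sup' _ _ ≤ _
      rw [hws]; exact mC_le_parent hl hu hw
    have h3 : dC q l u n p ≤ 3 * (√(6 / 31 * s (n + 1)) + √(s n - s (n + 1))) ^ 2 := by
      refine hk.trans ?_
      have : mC q l u n p - s (n + 1) ≤ s n - s (n + 1) := sub_le_sub_right (hle n p hpm) _
      have := Real.sqrt_le_sqrt this
      gcongr
    linarith
  have l1 : Tendsto (fun n => s (n + 1) - (totE q l u - ∑ w ∈ Wf l n, dC q l u n w)) atTop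
      (nhds (a - (totE q l u - totE q l u))) :=
    hlim1.sub (tendsto_const_nhds.sub (dC_sum_tendsto hl hu))
  have l2 : Tendsto (fun n => 3 * (√(6 / 31 * s (n + 1)) + √(s n - s (n + 1))) ^ 2) atTop
      (nhds (3 * (√(6 / 31 * a) + √(a - a)) ^ 2)) :=
    (((hlim1.const_mul _).sqrt.add (hlim.sub hlim1).sqrt).pow 2).const_mul _
  have l3 := le_of_tendsto_of_tendsto' l1 l2 hineq
  rw [sub_self, sub_zero, sub_self, Real.sqrt_zero, add_zero, Real.sq_sqrt (by positivity)] at l3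
  have ha0 : a = 0 := by linarith
  rw [ha0] at hlim
  obtain ⟨N, hN⟩ := (hlim.eventually (gt_mem_nhds hε)).exists_forall_of_atTop
  exact ⟨N, fun n hn w hw => (hle n w hw).trans_lt (hN n hn)⟩

end

/-! ### Geometry -/

def PP (q : Fin 3 → E2) (a b : ℝ) : E2 := q 0 + a • (q 1 - q 0) + b • (q 2 - q 0)

lemma PP_inj {q : Fin 3 → E2} (hq : ∀ j k : Fin 3, j ≠ k → dist (q j) (q k) = 1) {a b a' b' : ℝ}
    (h : PP q a b = PP q a' b') : a = a' ∧ b = b' := by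
  have h1 : ‖q 1 - q 0‖ = 1 := by rw [← dist_eq_norm]; exact hq 1 0 (by decide)
  have h2 : ‖q 2 - q 0‖ = 1 := by rw [← dist_eq_norm]; exact hq 2 0 (by decide)
  have h3 : ‖(q 1 - q 0) - (q 2 - q 0)‖ = 1 := by
    rw [sub_sub_sub_cancel_right, ← dist_eq_norm]; exact hq 1 2 (by decide)
  set e := q 1 - q 0
  set f := q 2 - q 0
  have h4 : (a - a') • e + (b - b') • f = 0 := by
    have : PP q a b - PP q a' b' = 0 := sub_eq_zero.2 h
    simp only [PP] at this
    rw [sub_smul, sub_smul, ← this]; abel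
  have h5 : inner ℝ e f = 1 / 2 := by
    have := norm_sub_sq_real e f
    rw [h1, h2, h3] at this; linarith
  have h6 : ‖(a - a') • e + (b - b') • f‖ ^ 2 = 0 := by rw [h4]; simp
  rw [norm_add_sq_real, norm_smul, norm_smul, h1, h2, inner_smul_left, inner_smul_right, h5] at h6
  simp only [mul_one, Real.norm_eq_abs, sq_abs, conj_trivial] at h6
  have h7 : (a - a') = 0 := by nlinarith [sq_nonneg (a - a' + 2 * (b - b')), sq_nonneg (a - a')]
  have h8 : (b - b') = 0 := by nlinarith [sq_nonneg (b - b' + 2 * (a - a')), sq_nonneg (b - b')]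
  exact ⟨sub_eq_zero.1 h7, sub_eq_zero.1 h8⟩

lemma mem_Tri {q : Fin 3 → E2} {x : E2} :
    x ∈ Tri q ↔ ∃ a b : ℝ, 0 ≤ a ∧ 0 ≤ b ∧ a + b ≤ 1 ∧ x = PP q a b := by
  constructor
  · intro hx
    have : Tri q ⊆ {x | ∃ a b : ℝ, 0 ≤ a ∧ 0 ≤ b ∧ a + b ≤ 1 ∧ x = PP q a b} := by
      refine convexHull_min ?_ ?_
      · rintro _ ⟨j, rfl⟩
        fin_cases j
        · exact ⟨0, 0, by norm_num, by norm_num, by norm_num, by simp [PP]⟩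
        · exact ⟨1, 0, by norm_num, by norm_num, by norm_num, by simp [PP]⟩
        · exact ⟨0, 1, by norm_num, by norm_num, by norm_num, by simp [PP]⟩
      · rintro _ ⟨a, b, ha, hb, hab, rfl⟩ _ ⟨a', b', ha', hb', hab', rfl⟩ s t hs ht hst
        refine ⟨s * a + t * a', s * b + t * b', by positivity, by positivity, ?_, ?_⟩
        · nlinarith
        · have : s = 1 - t := by linarith
          subst this
          simp only [PP]; module
    exact this hx
  · rintro ⟨a, b, ha, hb, hab, rfl⟩
    have h := (convex_convexHull ℝ (Set.range q)).sum_mem (t := Finset.univ)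
      (w := ![1 - a - b, a, b]) (z := q) (by
        intro i _; fin_cases i <;> simp <;> linarith) (by
        simp [Fin.sum_univ_three]; ring) (fun i _ => subset_convexHull ℝ _ ⟨i, rfl⟩)
    have e : PP q a b = ∑ i : Fin 3, (![1 - a - b, a, b] : Fin 3 → ℝ) i • q i := by
      simp only [Fin.sum_univ_three, PP]; simp; module
    rw [e]; exact h

lemma fmap_PP (q : Fin 3 → E2) (l : ℕ) (i : ℕ × ℕ) (a b : ℝ) :
    fmap q l i (PP q a b) = PP q ((i.1 + a) / l) ((i.2 + b) / l) := by
  simp only [fmap, PP, div_eq_mul_inv]; module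

def Ac (l : ℕ → ℕ) (w : ℕ → ℕ × ℕ) : ℕ → ℕ
  | 0 => 0
  | n + 1 => Ac l w n * l n + (w n).1

def Bc (l : ℕ → ℕ) (w : ℕ → ℕ × ℕ) : ℕ → ℕ
  | 0 => 0
  | n + 1 => Bc l w n * l n + (w n).2

lemma Ln_succ (l : ℕ → ℕ) (n : ℕ) : Ln l (n + 1) = Ln l n * l n := Finset.prod_range_succ _ _

lemma Ln_pos {l : ℕ → ℕ} (hl : ∀ n, 5 ≤ l n) (n : ℕ) : 0 < Ln l n :=
  Finset.prod_pos fun k _ => by have := hl k; omega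

lemma wordMap_PP (q : Fin 3 → E2) {l : ℕ → ℕ} (hl : ∀ n, 5 ≤ l n) (w : ℕ → ℕ × ℕ) (n : ℕ)
    (a b : ℝ) :
    wordMap q l w n (PP q a b) = PP q ((Ac l w n + a) / Ln l n) ((Bc l w n + b) / Ln l n) := by
  induction n generalizing a b with
  | zero => simp [wordMap, Ac, Bc, Ln]
  | succ n ih =>
    have h1 : (l n : ℝ) ≠ 0 := by have := hl n; positivity
    have h2 : (Ln l n : ℝ) ≠ 0 := by exact_mod_cast (Ln_pos hl n).ne'
    rw [wordMap, Function.comp, fmap_PP, ih, Ln_succ]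
    simp only [Ac, Bc]
    push_cast
    congr 1 <;> field_simp <;> ring

lemma AB_inj {l : ℕ → ℕ} (hl : ∀ n, 5 ≤ l n) {n : ℕ} {w w' : ℕ → ℕ × ℕ} (hw : w ∈ Wf l n)
    (hw' : w' ∈ Wf l n) (hA : Ac l w n = Ac l w' n) (hB : Bc l w n = Bc l w' n) : w = w' := by
  rw [mem_Wf] at hw hw'
  have key : ∀ m ≤ n, Ac l w m = Ac l w' m → Bc l w m = Bc l w' m → ∀ k < m, w k = w' k := by
    intro m
    induction m with
    | zero => intro _ _ _ k hk; omega
    | succ m ih =>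
      intro hm h1 h2 k hk
      have hs := (hw.1 m (by omega)).1
      have hs' := (hw'.1 m (by omega)).1
      have hlm := hl m
      simp only [Ac, Bc] at h1 h2
      have unq : ∀ a b c d : ℕ, b < l m → d < l m → a * l m + b = c * l m + d → a = c ∧ b = d := by
        intro a b c d hb hd h
        have e1 : (a * l m + b) / l m = a := by
          rw [add_comm, Nat.add_mul_div_right _ _ (by omega), Nat.div_eq_of_lt hb, zero_add]
        have e2 : (c * l m + d) / l m = c := by
          rw [add_comm, Nat.add_mul_div_right _ _ (by omega), Nat.div_eq_of_lt hd, zero_add]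
        have : a = c := by rw [← e1, h, e2]
        subst this
        exact ⟨rfl, by omega⟩
      obtain ⟨a1, a2⟩ := unq _ _ _ _ (by omega) (by omega) h1
      obtain ⟨b1, b2⟩ := unq _ _ _ _ (by omega) (by omega) h2
      rcases Nat.lt_succ_iff_lt_or_eq.1 hk with h | rfl
      · exact ih (by omega) a1 b1 k h
      · exact Prod.ext a2 b2
  funext k
  by_cases h : k < n
  · exact key n le_rfl hA hB k h
  · rw [hw.2 k (by omega), hw'.2 k (by omega)]

lemma mem_cell {q : Fin 3 → E2} (hq : ∀ j k : Fin 3, j ≠ k → dist (q j) (q k) = 1)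
    {l : ℕ → ℕ} (hl : ∀ n, 5 ≤ l n) {n : ℕ} {w : ℕ → ℕ × ℕ} {X Y : ℝ}
    (h : PP q (X / Ln l n) (Y / Ln l n) ∈ wordMap q l w n '' Tri q) :
    0 ≤ X - Ac l w n ∧ 0 ≤ Y - Bc l w n ∧ (X - Ac l w n) + (Y - Bc l w n) ≤ 1 := by
  obtain ⟨y, hy, e⟩ := h
  obtain ⟨a, b, ha, hb, hab, rfl⟩ := mem_Tri.1 hy
  rw [wordMap_PP q hl] at e
  have hL : (Ln l n : ℝ) ≠ 0 := by exact_mod_cast (Ln_pos hl n).ne'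
  obtain ⟨e1, e2⟩ := PP_inj hq e
  rw [div_left_inj' hL] at e1 e2
  refine ⟨by linarith, by linarith, by linarith⟩

lemma int_tri (a b : ℤ) (h1 : 0 ≤ a) (h2 : 0 ≤ b) (h3 : a + b ≤ 1) :
    (a = 0 ∧ b = 0) ∨ (a = 1 ∧ b = 0) ∨ (a = 0 ∧ b = 1) := by omega

lemma cell_inter {q : Fin 3 → E2} (hq : ∀ j k : Fin 3, j ≠ k → dist (q j) (q k) = 1)
    {l : ℕ → ℕ} (hl : ∀ n, 5 ≤ l n) {n : ℕ} {w w' : ℕ → ℕ × ℕ} (hw : w ∈ Wf l n)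
    (hw' : w' ∈ Wf l n) (hne : w ≠ w') {x : E2} (hx : x ∈ wordMap q l w n '' Tri q)
    (hx' : x ∈ wordMap q l w' n '' Tri q) : ∃ j, x = wordMap q l w n (q j) := by
  obtain ⟨y, hy, rfl⟩ := hx
  obtain ⟨a, b, ha, hb, hab, rfl⟩ := mem_Tri.1 hy
  rw [wordMap_PP q hl] at hx'
  obtain ⟨h1, h2, h3⟩ := mem_cell hq hl hx'
  -- integer differences
  obtain ⟨da, hda⟩ : ∃ d : ℤ, d = (Ac l w n : ℤ) - Ac l w' n := ⟨_, rfl⟩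
  obtain ⟨db, hdb⟩ : ∃ d : ℤ, d = (Bc l w n : ℤ) - Bc l w' n := ⟨_, rfl⟩
  have hda' : (da : ℝ) = Ac l w n - Ac l w' n := by rw [hda]; push_cast; ring
  have hdb' : (db : ℝ) = Bc l w n - Bc l w' n := by rw [hdb]; push_cast; ring
  have hnz : ¬ (da = 0 ∧ db = 0) := by
    rintro ⟨e1, e2⟩
    exact hne (AB_inj hl hw hw' (by omega) (by omega))
  have g1 : 0 ≤ a + da := by linarith
  have g2 : 0 ≤ b + db := by linarith
  have g3 : (a + da) + (b + db) ≤ 1 := by linarith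
  have k1 : -1 ≤ da := by
    have : (-1 : ℝ) ≤ da := by linarith
    exact_mod_cast this
  have k2 : -1 ≤ db := by
    have : (-1 : ℝ) ≤ db := by linarith
    exact_mod_cast this
  have k3 : da + db ≤ 1 := by
    have : (da : ℝ) + db ≤ 1 := by linarith
    exact_mod_cast this
  have k4 : -1 ≤ da + db := by
    have : (-1 : ℝ) ≤ da + db := by linarith
    exact_mod_cast this
  have vert : (a = 0 ∧ b = 0) ∨ (a = 1 ∧ b = 0) ∨ (a = 0 ∧ b = 1) := by
    have c1 : da ≤ 1 := by
      have : (da : ℝ) ≤ 1 := by linarith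
      exact_mod_cast this
    have c2 : db ≤ 1 := by
      have : (db : ℝ) ≤ 1 := by linarith
      exact_mod_cast this
    obtain h | h | h : da = -1 ∨ da = 0 ∨ da = 1 := by omega
    · subst h
      push_cast at *
      right; left; constructor <;> linarith
    · subst h
      obtain h' | h' : db = -1 ∨ db = 1 := by omega
      · subst h'
        push_cast at *
        right; right; constructor <;> linarith
      · subst h'
        push_cast at *
        left; constructor <;> linarith
    · subst h
      obtain h' | h' : db = -1 ∨ db = 0 := by omega
      · subst h'
        push_cast at *
        right; right; constructor <;> linarith
      · subst h'
        push_cast at *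
        left; constructor <;> linarith
  rcases vert with ⟨rfl, rfl⟩ | ⟨rfl, rfl⟩ | ⟨rfl, rfl⟩
  · exact ⟨0, by congr 1; simp [PP]⟩
  · exact ⟨1, by congr 1; simp [PP]⟩
  · exact ⟨2, by congr 1; simp [PP]⟩

lemma vertex_coord {q : Fin 3 → E2} {l : ℕ → ℕ} (hl : ∀ n, 5 ≤ l n) {n : ℕ} (w : ℕ → ℕ × ℕ)
    (j : Fin 3) (N : ℕ) (hN : n ≤ N) :
    ∃ X Y : ℕ, wordMap q l w n (q j) = PP q ((X : ℝ) / Ln l N) ((Y : ℝ) / Ln l N) := by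
  obtain ⟨c, hc⟩ : Ln l n ∣ Ln l N :=
    Finset.prod_dvd_prod_of_subset _ _ _ (Finset.range_subset_range.2 hN)
  have hL : (Ln l n : ℝ) ≠ 0 := by exact_mod_cast (Ln_pos hl n).ne'
  have hc0 : (c : ℝ) ≠ 0 := by
    have := Ln_pos hl N
    rw [hc] at this
    exact_mod_cast (pos_of_mul_pos_right this (Nat.zero_le _)).ne'
  obtain ⟨s, t, hst⟩ : ∃ s t : ℕ, q j = PP q s t := by
    fin_cases j
    · exact ⟨0, 0, by simp [PP]⟩
    · exact ⟨1, 0, by simp [PP]⟩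
    · exact ⟨0, 1, by simp [PP]⟩
  refine ⟨(Ac l w n + s) * c, (Bc l w n + t) * c, ?_⟩
  rw [hst, wordMap_PP q hl, hc]
  push_cast
  rw [mul_div_mul_right _ _ hc0, mul_div_mul_right _ _ hc0]

lemma vertex_card {q : Fin 3 → E2} (hq : ∀ j k : Fin 3, j ≠ k → dist (q j) (q k) = 1)
    {l : ℕ → ℕ} (hl : ∀ n, 5 ≤ l n) {n : ℕ} (w : ℕ → ℕ × ℕ) (j : Fin 3) (N : ℕ) (hN : n ≤ N)
    (A : Finset (ℕ → ℕ × ℕ)) (hA : A ⊆ Wf l N)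
    (hA' : ∀ v ∈ A, wordMap q l w n (q j) ∈ wordMap q l v N '' Tri q) : A.card ≤ 3 := by
  classical
  obtain ⟨X, Y, hXY⟩ := vertex_coord (q := q) hl w j N hN
  have h : A.card ≤ ({(0, 0), (1, 0), (0, 1)} : Finset (ℤ × ℤ)).card := by
    refine Finset.card_le_card_of_injOn
      (fun v => ((X : ℤ) - Ac l v N, (Y : ℤ) - Bc l v N)) ?_ ?_
    · intro v hv
      have := hA' v hv
      rw [hXY] at this
      obtain ⟨h1, h2, h3⟩ := mem_cell hq hl this
      have := int_tri ((X : ℤ) - Ac l v N) ((Y : ℤ) - Bc l v N) (by exact_mod_cast h1)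
        (by exact_mod_cast h2) (by exact_mod_cast h3)
      simpa using this
    · intro v hv v' hv' h
      simp only [Prod.mk.injEq, sub_right_inj, Nat.cast_inj] at h
      exact AB_inj hl (hA hv) (hA hv') h.1 h.2
  exact h.trans (by decide)

lemma Tri_compact (q : Fin 3 → E2) : IsCompact (Tri q) :=
  Set.Finite.isCompact_convexHull ℝ (Set.finite_range q)

lemma q_mem_Tri (q : Fin 3 → E2) (j : Fin 3) : q j ∈ Tri q := subset_convexHull ℝ _ ⟨j, rfl⟩

lemma fmap_continuous (q : Fin 3 → E2) (l : ℕ) (i : ℕ × ℕ) : Continuous (fmap q l i) := by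
  unfold fmap; fun_prop

lemma wordMap_continuous (q : Fin 3 → E2) (l : ℕ → ℕ) (w : ℕ → ℕ × ℕ) (n : ℕ) :
    Continuous (wordMap q l w n) := by
  induction n with
  | zero => exact continuous_id
  | succ n ih => exact ih.comp (fmap_continuous _ _ _)

lemma tri_closed (q : Fin 3 → E2) (l : ℕ → ℕ) (w : ℕ → ℕ × ℕ) (n : ℕ) :
    IsClosed (wordMap q l w n '' Tri q) :=
  ((Tri_compact q).image (wordMap_continuous q l w n)).isClosed

lemma wordMap_dist (q : Fin 3 → E2) {l : ℕ → ℕ} (hl : ∀ n, 5 ≤ l n) (w : ℕ → ℕ × ℕ) (n : ℕ)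
    (x y : E2) : dist (wordMap q l w n x) (wordMap q l w n y) ≤ (1 / 5) ^ n * dist x y := by
  induction n generalizing x y with
  | zero => simp [wordMap]
  | succ n ih =>
    refine (ih _ _).trans ?_
    have h5 : (5 : ℝ) ≤ l n := by exact_mod_cast hl n
    have : dist (fmap q (l n) (w n) x) (fmap q (l n) (w n) y) ≤ 1 / 5 * dist x y := by
      simp only [fmap, dist_add_left]
      rw [dist_smul₀, dist_sub_right, Real.norm_eq_abs, abs_of_nonneg (by positivity)]
      gcongr
      rw [inv_le_comm₀ (by positivity) (by norm_num)]; linarith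
    rw [pow_succ, mul_assoc]
    gcongr

lemma fmap_Tri {q : Fin 3 → E2} {l : ℕ} (hl : 5 ≤ l) {i : ℕ × ℕ} (hi : i.1 + i.2 ≤ l - 1) {x : E2}
    (hx : x ∈ Tri q) : fmap q l i x ∈ Tri q := by
  obtain ⟨a, b, ha, hb, hab, rfl⟩ := mem_Tri.1 hx
  rw [fmap_PP]
  have h1 : (0 : ℝ) < l := by positivity
  have h2 : (i.1 : ℝ) + i.2 + 1 ≤ l := by
    have : i.1 + i.2 + 1 ≤ l := by omega
    exact_mod_cast this
  refine mem_Tri.2 ⟨_, _, by positivity, by positivity, ?_, rfl⟩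
  rw [← add_div, div_le_one h1]; linarith

lemma tri_nested {q : Fin 3 → E2} {l : ℕ → ℕ} (hl : ∀ n, 5 ≤ l n) {n : ℕ} {w : ℕ → ℕ × ℕ}
    (hw : w ∈ Wf l n) (N : ℕ) (hN : N ≤ n) :
    wordMap q l w n '' Tri q ⊆ wordMap q l w N '' Tri q := by
  have hw' := (mem_Wf.1 hw).1
  clear hw
  induction n, hN using Nat.le_induction with
  | base => exact subset_rfl
  | succ m hm ih =>
    refine subset_trans ?_ (ih fun k hk => hw' k (by omega))
    rintro _ ⟨x, hx, rfl⟩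
    exact ⟨_, fmap_Tri (hl m) (hw' m (by omega)).1 hx, rfl⟩

/-! ### Measures -/

section meas

variable {q : Fin 3 → E2} {l : ℕ → ℕ} {u : E2 → ℝ}

/-- The prescribed mass of a cell. -/
def MM (q : Fin 3 → E2) (l : ℕ → ℕ) (u : E2 → ℝ) (n : ℕ) (w : ℕ → ℕ × ℕ) : ℝ≥0∞ :=
  ENNReal.ofReal (mC q l u n w)

/-- The closed triangle of a word. -/
def TT (q : Fin 3 → E2) (l : ℕ → ℕ) (n : ℕ) (w : ℕ → ℕ × ℕ) : Set E2 := wordMap q l w n '' Tri q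

lemma MM_sum (hl : ∀ n, 5 ≤ l n) (hu : u ∈ FDom q l) (n : ℕ) :
    ∑ w ∈ Wf l n, MM q l u n w = ENNReal.ofReal (totE q l u) := by
  rw [← mC_sum hl hu n, ENNReal.ofReal_sum_of_nonneg fun w hw => mC_nonneg hl hu hw]
  rfl

lemma MM_succ (hl : ∀ n, 5 ≤ l n) (hu : u ∈ FDom q l) {n : ℕ} {w : ℕ → ℕ × ℕ}
    (hw : w ∈ Wf l n) :
    MM q l u n w = ∑ i ∈ Sf (l n), MM q l u (n + 1) (Function.update w n i) := by
  rw [MM, mC_succ hl hu hw,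
    ENNReal.ofReal_sum_of_nonneg fun i hi => mC_nonneg hl hu (update_mem hw hi)]
  rfl

/-- Truncation of a word. -/
def trW (N : ℕ) (w : ℕ → ℕ × ℕ) : ℕ → ℕ × ℕ := fun k => if k < N then w k else (0, 0)

lemma trunc_sum (hl : ∀ n, 5 ≤ l n) (hu : u ∈ FDom q l) {N n : ℕ} (hN : N ≤ n)
    (f : (ℕ → ℕ × ℕ) → ℝ≥0∞) :
    ∑ w ∈ Wf l n, MM q l u n w * f (trW N w) = ∑ v ∈ Wf l N, MM q l u N v * f v := by
  induction n, hN using Nat.le_induction with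
  | base =>
    refine Finset.sum_congr rfl fun w hw => ?_
    have : trW N w = w := by
      funext k
      simp only [trW]
      split_ifs with h
      · rfl
      · exact ((mem_Wf.1 hw).2 k (by omega)).symm
    rw [this]
  | succ m hm ih =>
    rw [sum_Wf_succ, ← ih]
    refine Finset.sum_congr rfl fun w hw => ?_
    rw [MM_succ hl hu hw, Finset.sum_mul]
    refine Finset.sum_congr rfl fun i hi => ?_
    congr 2
    funext k
    simp only [trW]
    split_ifs with h
    · exact Function.update_of_ne (by omega) _ _
    · rfl

/-- Discrete approximations. -/
def muM (q : Fin 3 → E2) (l : ℕ → ℕ) (u : E2 → ℝ) (k : ℕ) : Measure E2 :=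
  ∑ w ∈ Wf l k, MM q l u k w • Measure.dirac (wordMap q l w k (q 0))

lemma muM_apply (k : ℕ) {S : Set E2} (hS : MeasurableSet S) :
    muM q l u k S = ∑ w ∈ Wf l k, MM q l u k w * S.indicator 1 (wordMap q l w k (q 0)) := by
  simp [muM, Measure.finsetSum_apply, Measure.dirac_apply' _ hS]

lemma muM_univ (hl : ∀ n, 5 ≤ l n) (hu : u ∈ FDom q l) (k : ℕ) :
    muM q l u k univ = ENNReal.ofReal (totE q l u) := by
  rw [muM_apply k MeasurableSet.univ, ← MM_sum hl hu k]
  simp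

lemma TT_closed (n : ℕ) (w : ℕ → ℕ × ℕ) : IsClosed (TT q l n w) := tri_closed q l w n

lemma UU_closed (n : ℕ) (A : Finset (ℕ → ℕ × ℕ)) : IsClosed (⋃ v ∈ A, TT q l n v) :=
  A.finite_toSet.isClosed_biUnion fun v _ => TT_closed n v

lemma pt_mem (hl : ∀ n, 5 ≤ l n) {N n : ℕ} (hN : N ≤ n) {w : ℕ → ℕ × ℕ} (hw : w ∈ Wf l n) :
    wordMap q l w n (q 0) ∈ TT q l N (trW N w) := by
  have h := tri_nested (q := q) hl hw N hN ⟨q 0, q_mem_Tri q 0, rfl⟩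
  rw [wordMap_congr q l (w := w) (w' := trW N w) N (fun k hk => by simp [trW, hk])] at h
  exact h

lemma muM_lower (hl : ∀ n, 5 ≤ l n) (hu : u ∈ FDom q l) {N n : ℕ} (hN : N ≤ n)
    (A : Finset (ℕ → ℕ × ℕ)) (hA : A ⊆ Wf l N) :
    ∑ v ∈ A, MM q l u N v ≤ muM q l u n (⋃ v ∈ A, TT q l N v) := by
  classical
  rw [muM_apply n (UU_closed N A).measurableSet]
  have h := trunc_sum (q := q) (u := u) hl hu hN (fun v => if v ∈ A then 1 else 0)
  have e : ∑ v ∈ Wf l N, MM q l u N v * (if v ∈ A then 1 else 0) = ∑ v ∈ A, MM q l u N v := by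
    simp only [mul_ite, mul_one, mul_zero]
    rw [← Finset.sum_filter, Finset.filter_mem_eq_inter, Finset.inter_eq_right.2 hA]
  rw [← e, ← h]
  refine Finset.sum_le_sum fun w hw => ?_
  gcongr
  split_ifs with h1
  · rw [Set.indicator_of_mem]
    · rfl
    · exact Set.mem_biUnion h1 (pt_mem hl hN hw)
  · exact zero_le

lemma muM_finite (k : ℕ) : IsFiniteMeasure (muM q l u k) := by
  refine ⟨?_⟩
  rw [muM_apply k MeasurableSet.univ]
  simp only [Set.indicator_univ, Pi.one_apply, mul_one]
  exact ENNReal.sum_lt_top.2 fun w _ => ENNReal.ofReal_lt_top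

lemma exists_limit (hl : ∀ n, 5 ≤ l n) (hu : u ∈ FDom q l) :
    ∃ μ : Measure E2, μ univ = ENNReal.ofReal (totE q l u) ∧
      ∀ N, ∀ A : Finset (ℕ → ℕ × ℕ), A ⊆ Wf l N →
        ∑ v ∈ A, MM q l u N v ≤ μ (⋃ v ∈ A, TT q l N v) := by
  classical
  let ms : ℕ → FiniteMeasure E2 := fun k => ⟨muM q l u k, muM_finite k⟩
  have hms : ∀ k S, ((ms k : FiniteMeasure E2) : Measure E2) S = muM q l u k S := fun _ _ => rfl
  set C : NNReal := (totE q l u).toNNReal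
  have hcpt := isCompact_setOfPred_finiteMeasure_le_of_isCompact C (Tri_compact q)
  have hin : ∀ k, ms k ∈ {μ : FiniteMeasure E2 | μ.mass ≤ C ∧ μ (Tri q)ᶜ = 0} := by
    intro k
    constructor
    · rw [← ENNReal.coe_le_coe, FiniteMeasure.ennreal_mass, hms, muM_univ hl hu]
      rfl
    · rw [← ENNReal.coe_eq_zero, FiniteMeasure.ennreal_coeFn_eq_coeFn_toMeasure, hms,
        muM_apply k (Tri_compact q).isClosed.measurableSet.compl]
      refine Finset.sum_eq_zero fun w hw => ?_
      have h : wordMap q l w k (q 0) ∈ Tri q := by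
        have := tri_nested (q := q) hl hw 0 (Nat.zero_le _) ⟨q 0, q_mem_Tri q 0, rfl⟩
        simpa [wordMap] using this
      rw [Set.indicator_of_notMem (by simpa using h), mul_zero]
  obtain ⟨μ, hμ, hlim⟩ := hcpt.ultrafilter_le_nhds' ((hyperfilter ℕ).map ms)
    (Filter.mem_map.2 (Filter.univ_mem' hin))
  have hlim : Tendsto ms (hyperfilter ℕ : Filter ℕ) (nhds μ) := hlim
  have key : ∀ F : Set E2, IsClosed F → ∀ c, ∀ N : ℕ, (∀ n ≥ N, c ≤ muM q l u n F) →
      c ≤ (μ : Measure E2) F := by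
    intro F hF c N h
    refine le_trans ?_ (FiniteMeasure.limsup_measure_closed_le_of_tendsto hlim hF)
    refine le_limsup_of_frequently_le' (Eventually.frequently ?_)
    have : ∀ᶠ n in atTop, c ≤ ((ms n : FiniteMeasure E2) : Measure E2) F :=
      eventually_atTop.2 ⟨N, h⟩
    exact (Nat.hyperfilter_le_atTop) this
  refine ⟨μ, le_antisymm ?_ ?_, ?_⟩
  · rw [← FiniteMeasure.ennreal_mass]
    exact ENNReal.coe_le_coe.2 hμ.1
  · exact key _ isClosed_univ _ 0 fun n _ => (muM_univ hl hu n).ge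
  · intro N A hA
    exact key _ (UU_closed N A) _ N fun n hn => muM_lower hl hu hn A hA

lemma Gasket_eq : Gasket q l = ⋂ n, ⋃ v ∈ Wf l n, TT q l n v := by
  simp only [Gasket, TT, mem_Wf]

lemma MM_uniform (hl : ∀ n, 5 ≤ l n) (hu : u ∈ FDom q l) (ε : ℝ≥0∞) (hε : 0 < ε) :
    ∃ N, ∀ n ≥ N, ∀ w ∈ Wf l n, MM q l u n w ≤ ε := by
  by_cases ht : ε = ⊤
  · exact ⟨0, fun n _ w _ => ht ▸ le_top⟩
  obtain ⟨N, hN⟩ := mC_uniform (q := q) hl hu ε.toReal (ENNReal.toReal_pos hε.ne' ht)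
  exact ⟨N, fun n hn w hw => ENNReal.ofReal_le_of_le_toReal (hN n hn w hw).le⟩

lemma sum_split_lt [DecidableEq (ℕ → ℕ × ℕ)] (hl : ∀ n, 5 ≤ l n) (hu : u ∈ FDom q l) (n : ℕ) (A B : Finset (ℕ → ℕ × ℕ))
    (hAB : A ∪ B = Wf l n) (hd : Disjoint A B) :
    ∑ v ∈ A, MM q l u n v + ∑ v ∈ B, MM q l u n v = ENNReal.ofReal (totE q l u) := by
  rw [← MM_sum hl hu n, ← hAB, Finset.sum_union hd]

lemma exists_measure (hq : ∀ j k : Fin 3, j ≠ k → dist (q j) (q k) = 1)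
    (hl : ∀ n, 5 ≤ l n) (hu : u ∈ FDom q l) : ∃ μ : Measure E2, IsEnergyMeasure q l u μ := by
  classical
  obtain ⟨μ, hμ1, hμ2⟩ := exists_limit (q := q) hl hu
  have hfin : IsFiniteMeasure μ := ⟨by rw [hμ1]; exact ENNReal.ofReal_lt_top⟩
  have hnull : ∀ N, μ (⋃ v ∈ Wf l N, TT q l N v)ᶜ = 0 := by
    intro N
    rw [measure_compl (UU_closed N _).measurableSet (measure_ne_top _ _), hμ1,
      tsub_eq_zero_iff_le, ← MM_sum hl hu N]
    exact hμ2 N _ subset_rfl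
  have hK : μ (Gasket q l)ᶜ = 0 := by
    rw [Gasket_eq, Set.compl_iInter]
    exact measure_iUnion_null hnull
  have hvert : ∀ n w, ∀ j : Fin 3, μ {wordMap q l w n (q j)} = 0 := by
    intro n w j
    set x := wordMap q l w n (q j) with hx
    by_contra hne
    have hpos : 0 < μ {x} := pos_iff_ne_zero.2 hne
    obtain ⟨N, hN⟩ := MM_uniform (q := q) hl hu (μ {x} / 4) (ENNReal.div_pos hne (by norm_num))
    set m := max N n
    set A := (Wf l m).filter fun v => x ∉ TT q l m v with hA
    set B := (Wf l m).filter fun v => x ∈ TT q l m v with hB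
    have hsum := sum_split_lt (q := q) (u := u) hl hu m B A
      (Finset.filter_union_filter_not_eq _ _) (Finset.disjoint_filter_filter_not _ _ _)
    have hBc : B.card ≤ 3 := vertex_card hq hl w j m (le_max_right _ _) B
      (Finset.filter_subset _ _) fun v hv => (Finset.mem_filter.1 hv).2
    have hBs : ∑ v ∈ B, MM q l u m v ≤ 3 * (μ {x} / 4) := by
      refine (Finset.sum_le_card_nsmul _ _ _ fun v hv => hN m (le_max_left _ _) v
        (Finset.filter_subset _ _ hv)).trans ?_
      rw [nsmul_eq_mul]
      gcongr
      exact_mod_cast hBc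
    have hdis : Disjoint {x} (⋃ v ∈ A, TT q l m v) := by
      rw [Set.disjoint_singleton_left]
      simp only [Set.mem_iUnion, not_exists]
      exact fun v hv => (Finset.mem_filter.1 hv).2
    have h1 : μ {x} + μ (⋃ v ∈ A, TT q l m v) ≤ μ univ := by
      rw [← measure_union hdis (UU_closed m A).measurableSet]
      exact measure_mono (subset_univ _)
    have h2 := hμ2 m A (Finset.filter_subset _ _)
    have h3 : μ {x} + ∑ v ∈ A, MM q l u m v ≤ 3 * (μ {x} / 4) + ∑ v ∈ A, MM q l u m v := by
      calc _ ≤ μ {x} + μ (⋃ v ∈ A, TT q l m v) := by gcongr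
        _ ≤ μ univ := h1
        _ = _ := by rw [hμ1, ← hsum]
        _ ≤ _ := by gcongr
    have hAfin : ∑ v ∈ A, MM q l u m v ≠ ⊤ :=
      (ENNReal.sum_lt_top.2 fun v _ => ENNReal.ofReal_lt_top).ne
    have h4 : μ {x} ≤ 3 * (μ {x} / 4) := (ENNReal.add_le_add_iff_right hAfin).1 h3
    have hxf : μ {x} ≠ ⊤ := measure_ne_top _ _
    have h5 := ENNReal.toReal_mono (ENNReal.mul_ne_top (by norm_num)
      (ENNReal.div_ne_top hxf (by norm_num))) h4
    rw [ENNReal.toReal_mul, ENNReal.toReal_div] at h5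
    have h6 := ENNReal.toReal_pos hne hxf
    norm_num at h5
    linarith
  have hcell : ∀ n w, μ (Cell q l n w) = μ (TT q l n w) := by
    intro n w
    have : Cell q l n w = TT q l n w ∩ Gasket q l := Set.inter_comm _ _
    rw [this]
    exact measure_inter_conull hK
  have haed : ∀ n, (↑(Wf l n) : Set (ℕ → ℕ × ℕ)).Pairwise
      (Function.onFun (AEDisjoint μ) (TT q l n)) := by
    intro n w hw w' hw' hne
    have hsub : TT q l n w ∩ TT q l n w' ⊆ ⋃ j : Fin 3, {wordMap q l w n (q j)} := by
      rintro x ⟨hx, hx'⟩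
      obtain ⟨j, hj⟩ := cell_inter hq hl hw hw' hne hx hx'
      exact Set.mem_iUnion.2 ⟨j, hj⟩
    exact measure_mono_null hsub (measure_iUnion_null fun j => hvert n w j)
  refine ⟨μ, hK, fun n w hw => ?_⟩
  have hw := mem_Wf.2 hw
  rw [hcell]
  show _ = MM q l u n w
  have hsum : ∑ v ∈ Wf l n, μ (TT q l n v) ≤ ∑ v ∈ Wf l n, MM q l u n v := by
    rw [← measure_biUnion_finset₀ (haed n) (fun v _ => (TT_closed n v).nullMeasurableSet),
      MM_sum hl hu, ← hμ1]
    exact measure_mono (subset_univ _)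
  have hge : ∀ v ∈ Wf l n, MM q l u n v ≤ μ (TT q l n v) := by
    intro v hv
    simpa using hμ2 n {v} (by simpa using hv)
  refine le_antisymm ?_ (hge w hw)
  rw [← Finset.add_sum_erase _ _ hw, ← Finset.add_sum_erase _ _ hw] at hsum
  have hfin2 : ∑ v ∈ (Wf l n).erase w, MM q l u n v ≠ ⊤ :=
    (ENNReal.sum_lt_top.2 fun v _ => ENNReal.ofReal_lt_top).ne
  refine (ENNReal.add_le_add_iff_right hfin2).1 (le_trans ?_ hsum)
  gcongr with v hv
  exact hge v (Finset.mem_of_mem_erase hv)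

lemma Gasket_cover (n : ℕ) : Gasket q l ⊆ ⋃ v ∈ Wf l n, Cell q l n v := by
  intro x hx
  have h := hx
  rw [Gasket_eq] at h
  obtain ⟨v, hv, hxv⟩ := Set.mem_iUnion₂.1 (Set.mem_iInter.1 h n)
  exact Set.mem_iUnion₂.2 ⟨v, hv, hx, hxv⟩

lemma energy_noatom (hl : ∀ n, 5 ≤ l n) (hu : u ∈ FDom q l) {μ : Measure E2}
    (hμ : IsEnergyMeasure q l u μ) {x : E2} (hx : x ∈ Gasket q l) : μ {x} = 0 := by
  by_contra hne
  have hpos : 0 < μ {x} := pos_iff_ne_zero.2 hne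
  obtain ⟨ε, hε, hεx⟩ := exists_between hpos
  obtain ⟨N, hN⟩ := MM_uniform (q := q) hl hu ε hε
  obtain ⟨v, hv, hxv⟩ := Set.mem_iUnion₂.1 (Gasket_cover N hx)
  have h1 : μ {x} ≤ μ (Cell q l N v) := measure_mono (by simpa using hxv)
  rw [hμ.2 N v (mem_Wf.1 hv)] at h1
  exact absurd (h1.trans (hN N le_rfl v hv)) (not_le.2 hεx)

lemma energy_univ (hl : ∀ n, 5 ≤ l n) (hu : u ∈ FDom q l) {μ : Measure E2}
    (hμ : IsEnergyMeasure q l u μ) : μ univ = ENNReal.ofReal (totE q l u) := by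
  have h0 := Gasket_cover (q := q) (l := l) 0
  rw [Wf_zero] at h0
  simp only [Finset.mem_singleton, Set.iUnion_iUnion_eq_left] at h0
  have e : Cell q l 0 (fun _ => (0, 0)) = Gasket q l := subset_antisymm Set.inter_subset_left h0
  have h1 := hμ.2 0 _ (mem_Wf.1 (zero_mem_Wf hl 0))
  rw [e] at h1
  have h2 : μ univ = μ (Gasket q l) := by
    have := measure_inter_conull (s := univ) hμ.1
    rw [← this, Set.univ_inter]
  have h3 := MM_sum (q := q) (u := u) hl hu 0
  rw [Wf_zero, Finset.sum_singleton] at h3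
  rw [h2, h1, ← h3]
  rfl

lemma energy_le_closed (hl : ∀ n, 5 ≤ l n) (hu : u ∈ FDom q l) {μ ν : Measure E2}
    (hμ : IsEnergyMeasure q l u μ) (hν : IsEnergyMeasure q l u ν) {C : Set E2} (hC : IsClosed C) :
    μ C ≤ ν C := by
  classical
  have hfin : IsFiniteMeasure ν := ⟨by rw [energy_univ hl hu hν]; exact ENNReal.ofReal_lt_top⟩
  have hlow : ∀ n, ∀ A ⊆ Wf l n, ∑ v ∈ A, MM q l u n v ≤ ν (⋃ v ∈ A, Cell q l n v) := by
    intro n A hA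
    have h1 := sum_split_lt (q := q) (u := u) hl hu n A (Wf l n \ A)
      (Finset.union_sdiff_of_subset hA) Finset.disjoint_sdiff
    have hup : ν (⋃ v ∈ Wf l n \ A, Cell q l n v) ≤ ∑ v ∈ Wf l n \ A, MM q l u n v := by
      refine (measure_biUnion_finset_le _ _).trans (Finset.sum_le_sum fun v hv => ?_)
      exact (hν.2 n v (mem_Wf.1 (Finset.mem_sdiff.1 hv).1)).le
    have hcov : ν univ ≤ ν (⋃ v ∈ A, Cell q l n v) + ν (⋃ v ∈ Wf l n \ A, Cell q l n v) := by
      rw [← measure_inter_conull (s := univ) hν.1]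
      refine (measure_mono ?_).trans (measure_union_le _ _)
      intro x hx
      obtain ⟨v, hv, hxv⟩ := Set.mem_iUnion₂.1 (Gasket_cover n hx.2)
      by_cases hvA : v ∈ A
      · exact Or.inl (Set.mem_iUnion₂.2 ⟨v, hvA, hxv⟩)
      · exact Or.inr (Set.mem_iUnion₂.2 ⟨v, Finset.mem_sdiff.2 ⟨hv, hvA⟩, hxv⟩)
    have hf : ∑ v ∈ Wf l n \ A, MM q l u n v ≠ ⊤ :=
      (ENNReal.sum_lt_top.2 fun v _ => ENNReal.ofReal_lt_top).ne
    refine (ENNReal.add_le_add_iff_right hf).1 ?_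
    rw [h1, ← energy_univ hl hu hν]
    exact hcov.trans (by gcongr)
  set D := Metric.diam (Tri q)
  have hstep : ∀ n : ℕ, μ C ≤ ν (Metric.cthickening ((1 / 5) ^ n * D) C) := by
    intro n
    set A := (Wf l n).filter fun v => (Cell q l n v ∩ C).Nonempty with hA
    have h1 : μ C ≤ ∑ v ∈ A, MM q l u n v := by
      rw [← measure_inter_conull (s := C) hμ.1]
      have hsub : C ∩ Gasket q l ⊆ ⋃ v ∈ A, Cell q l n v := by
        rintro x ⟨hxC, hxK⟩
        obtain ⟨v, hv, hxv⟩ := Set.mem_iUnion₂.1 (Gasket_cover n hxK)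
        exact Set.mem_iUnion₂.2 ⟨v, Finset.mem_filter.2 ⟨hv, x, hxv, hxC⟩, hxv⟩
      refine (measure_mono hsub).trans ((measure_biUnion_finset_le _ _).trans
        (Finset.sum_le_sum fun v hv => ?_))
      exact (hμ.2 n v (mem_Wf.1 (Finset.mem_filter.1 hv).1)).le
    refine h1.trans ((hlow n A (Finset.filter_subset _ _)).trans (measure_mono ?_))
    refine Set.iUnion₂_subset fun v hv => ?_
    rintro x ⟨-, a, ha, rfl⟩
    obtain ⟨_, ⟨-, b, hb, rfl⟩, hyC⟩ := (Finset.mem_filter.1 hv).2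
    refine Metric.mem_cthickening_of_dist_le _ _ _ _ hyC ((wordMap_dist q hl v n a b).trans ?_)
    gcongr
    exact Metric.dist_le_diam_of_mem (Tri_compact q).isBounded ha hb
  have hlim : Tendsto (fun n : ℕ => (1 / 5 : ℝ) ^ n * D) atTop (nhds 0) := by
    have := (tendsto_pow_atTop_nhds_zero_of_lt_one (r := (1 / 5 : ℝ)) (by norm_num)
      (by norm_num)).mul_const D
    simpa using this
  have h2 := (tendsto_measure_cthickening_of_isClosed (μ := ν) (s := C)
    ⟨1, one_pos, measure_ne_top _ _⟩ hC).comp hlim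
  exact ge_of_tendsto' h2 hstep

lemma energy_unique (hl : ∀ n, 5 ≤ l n) (hu : u ∈ FDom q l) {μ ν : Measure E2}
    (hμ : IsEnergyMeasure q l u μ) (hν : IsEnergyMeasure q l u ν) : μ = ν := by
  have hfin : IsFiniteMeasure μ := ⟨by rw [energy_univ hl hu hμ]; exact ENNReal.ofReal_lt_top⟩
  refine ext_of_generate_finite {s | IsClosed s} ?_ isPiSystem_isClosed ?_ ?_
  · rw [← borel_eq_generateFrom_isClosed]
    exact BorelSpace.measurable_eq
  · intro s hs
    exact le_antisymm (energy_le_closed hl hu hμ hν hs) (energy_le_closed hl hu hν hμ hs)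
  · rw [energy_univ hl hu hμ, energy_univ hl hu hν]

end meas

/-- For every `u ∈ F` there is a unique Borel measure `μ` on `K` with
`μ(K_w) = R_{|w|}⁻¹ E^{𝒍^{|w|}}(u∘F_w, u∘F_w)` for all words `w`; moreover it has no
atoms. -/
theorem stmt14 (q : Fin 3 → E2) (hq : ∀ j k : Fin 3, j ≠ k → dist (q j) (q k) = 1)
    (l : ℕ → ℕ) (hl : ∀ n, 5 ≤ l n) (u : E2 → ℝ) (hu : u ∈ FDom q l) :
    (∃! μ : Measure E2, IsEnergyMeasure q l u μ) ∧
    (∀ μ : Measure E2, IsEnergyMeasure q l u μ → ∀ x ∈ Gasket q l, μ {x} = 0) := by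
  refine ⟨?_, fun μ hμ x hx => energy_noatom hl hu hμ hx⟩
  obtain ⟨μ, hμ⟩ := exists_measure hq hl hu
  exact ⟨μ, hμ, fun ν hν => energy_unique hl hu hν hμ⟩
end
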